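/- The Scott topology Σ(S) of a continuous basic cover S is the de Groot dual of the lower powerlocale Lower(S); consequently, the Lawson topology satisfies L(S) ≅ Patch(Σ(S)). -/

import Mathlib

noncomputable section
open Classical

universe u v

namespace FTP

/-! ### Basic covers -/

/-- `U ◁ V` : every element of `U` is covered by `V`. -/
def covS {S : Type*} (cov : S → Set S → Prop) (U V : Set S) : Prop :=
  ∀ a ∈ U, cov a V

/-- A basic cover: reflexivity and transitivity. -/
def IsBasicCover {S : Type*} (cov : S → Set S → Prop) : Prop :=
  (∀ (a : S) (U : Set S), a ∈ U → cov a U) ∧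
  (∀ (a : S) (U V : Set S), cov a U → covS cov U V → cov a V)

/-- the way-below relation `a ≪ b`. -/
def wb {S : Type*} (cov : S → Set S → Prop) (a b : S) : Prop :=
  ∀ U : Set S, cov b U → ∃ U₀ : Finset S, ↑U₀ ⊆ U ∧ cov a ↑U₀

/-- the way-below relation between subsets `U ≪ V`. -/
def wbS {S : Type*} (cov : S → Set S → Prop) (U V : Set S) : Prop :=
  ∀ W : Set S, covS cov V W → ∃ W₀ : Finset S, ↑W₀ ⊆ W ∧ covS cov U ↑W₀

/-- A continuous basic cover, with the witnessing function `w`. -/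
def IsContinuous {S : Type*} (cov : S → Set S → Prop) (w : S → Set S) : Prop :=
  (∀ a : S, ∀ b ∈ w a, wb cov b a) ∧ (∀ a : S, cov a (w a))

/-- splitting subsets. -/
def Splitting {S : Type*} (cov : S → Set S → Prop) (V : Set S) : Prop :=
  ∀ (a : S) (U : Set S), a ∈ V → cov a U → (V ∩ U).Nonempty

/-- located subsets. -/
def Located {S : Type*} (cov : S → Set S → Prop) (V : Set S) : Prop :=
  Splitting cov V ∧ ∀ a b : S, wb cov a b → a ∉ V ∨ b ∈ V

/-- inverse image of a relation. -/
def rinv {α β : Type*} (r : α → β → Prop) (U : Set β) : Set α :=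
  {x | ∃ a ∈ U, r x a}

/-- basic cover maps. -/
def IsBCM {α β : Type*} (cov : α → Set α → Prop) (cov' : β → Set β → Prop)
    (r : α → β → Prop) : Prop :=
  ∀ (a : β) (U : Set β), cov' a U → covS cov (rinv r {a}) (rinv r U)

/-- perfect maps. -/
def IsPerfect {α β : Type*} (cov : α → Set α → Prop) (cov' : β → Set β → Prop)
    (r : α → β → Prop) : Prop :=
  ∀ a b : β, wb cov' a b → wbS cov (rinv r {a}) (rinv r {b})

/-- the terminal basic cover `1 = ({∗}, ∈)`. -/
def unitCov : Unit → Set Unit → Prop := fun x U => x ∈ U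

/-! ### Formal topologies -/

/-- `U ↓ V` with respect to a preorder `le`. -/
def down {S : Type*} (le : S → S → Prop) (U V : Set S) : Set S :=
  {c | ∃ a ∈ U, ∃ b ∈ V, le c a ∧ le c b}

/-- A formal topology: a basic cover together with a compatible preorder. -/
def IsFormalTopology {S : Type*} (cov : S → Set S → Prop) (le : S → S → Prop) : Prop :=
  IsBasicCover cov ∧ Reflexive le ∧ Transitive le ∧
  (∀ a b : S, le a b → cov a {b}) ∧
  (∀ (a : S) (U V : Set S), cov a U → cov a V → cov a (down le U V))

/-- formal topology maps. -/
def IsFTM {α β : Type*} (cov : α → Set α → Prop) (le : α → α → Prop)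
    (cov' : β → Set β → Prop) (le' : β → β → Prop) (r : α → β → Prop) : Prop :=
  IsBCM cov cov' r ∧
  covS cov Set.univ (rinv r Set.univ) ∧
  ∀ a b : β, covS cov (down le (rinv r {a}) (rinv r {b})) (rinv r (down le' {a} {b}))

/-- the order on maps. -/
def MapLE {α β : Type*} (cov : α → Set α → Prop) (r s : α → β → Prop) : Prop :=
  ∀ a : β, covS cov (rinv r {a}) (rinv s {a})

/-- equality of maps. -/
def MapEq {α β : Type*} (cov : α → Set α → Prop) (r s : α → β → Prop) : Prop :=
  MapLE cov r s ∧ MapLE cov s r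

/-- composition of relational maps (`comp s r = s ∘ r`). -/
def comp {α β γ : Type*} (s : β → γ → Prop) (r : α → β → Prop) : α → γ → Prop :=
  fun x c => ∃ b, r x b ∧ s b c

/-- `b* = {c | c ↓ b ◁ ∅}`. -/
def star {S : Type*} (cov : S → Set S → Prop) (le : S → S → Prop) (b : S) : Set S :=
  {c | covS cov (down le {c} {b}) ∅}

/-- `b ⋘ a` iff `S ◁ b* ∪ {a}`. -/
def wc {S : Type*} (cov : S → Set S → Prop) (le : S → S → Prop) (b a : S) : Prop :=
  covS cov Set.univ (star cov le b ∪ {a})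

/-- regular formal topologies. -/
def Regular {S : Type*} (cov : S → Set S → Prop) (le : S → S → Prop) : Prop :=
  ∀ a : S, cov a {b | wc cov le b a}

/-- compactness: `S ≪ S`. -/
def Compact {S : Type*} (cov : S → Set S → Prop) : Prop :=
  wbS cov Set.univ Set.univ

/-- stability: `a ≪ a'` and `b ≪ b'` imply `a↓b ≪ a'↓b'`. -/
def Stable {S : Type*} (cov : S → Set S → Prop) (le : S → S → Prop) : Prop :=
  ∀ a a' b b' : S, wb cov a a' → wb cov b b' →
    wbS cov (down le {a} {b}) (down le {a'} {b'})

/-- isomorphism of formal topologies. -/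
def IsIso {α β : Type*} (cov : α → Set α → Prop) (le : α → α → Prop)
    (cov' : β → Set β → Prop) (le' : β → β → Prop) : Prop :=
  ∃ (r : α → β → Prop) (s : β → α → Prop),
    IsFTM cov le cov' le' r ∧ IsFTM cov' le' cov le s ∧
    MapEq cov (comp s r) (fun a b => a = b) ∧
    MapEq cov' (comp r s) (fun a b => a = b)

/-! ### Geometric theories and the covers they present -/

/-- the preorder `A ≤ B ↔ B ⊆ A` on finite sets of generators. -/
def supord {P : Type*} : Finset P → Finset P → Prop := fun A B => B ⊆ A

/-- The cover on `Finset P` inductively generated by a geometric theory `T`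
(an axiom `T A 𝒞` means `⋀A ⊢ ⋁_{B ∈ 𝒞} ⋀B`). -/
inductive GCov {P : Type*} (T : Finset P → Set (Finset P) → Prop) :
    Finset P → Set (Finset P) → Prop where
  | refl {A : Finset P} {𝒰 : Set (Finset P)} : A ∈ 𝒰 → GCov T A 𝒰
  | le {A B : Finset P} {𝒰 : Set (Finset P)} : B ⊆ A → GCov T B 𝒰 → GCov T A 𝒰
  | ax {A : Finset P} {𝒞 𝒰 : Set (Finset P)} (C : Finset P) :
      T A 𝒞 → (∀ B ∈ 𝒞, GCov T (C ∪ B) 𝒰) → GCov T (C ∪ A) 𝒰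

theorem GCov_trans {P : Type*} {T : Finset P → Set (Finset P) → Prop}
    {A : Finset P} {𝒰 𝒱 : Set (Finset P)}
    (h : GCov T A 𝒰) (h' : ∀ B ∈ 𝒰, GCov T B 𝒱) : GCov T A 𝒱 := by
  induction h with
  | refl hA => exact h' _ hA
  | le hBA _ ih => exact GCov.le hBA (ih h')
  | ax C hT _ ih => exact GCov.ax C hT (fun B hB => ih B hB h')

theorem GCov_isBasicCover {P : Type*} (T : Finset P → Set (Finset P) → Prop) :
    IsBasicCover (GCov T) :=
  ⟨fun _ _ h => GCov.refl h, fun _ _ _ h h' => GCov_trans h h'⟩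

/-! ### The patch, Lawson and lower powerlocale theories -/

/-- generators of the patch/Lawson theories : `r a` and `l A`. -/
inductive PatchGen (S : Type u) : Type u where
  | r : S → PatchGen S
  | l : Finset S → PatchGen S

/-- The geometric theory `T_P` presenting the patch of a stably locally compact
formal topology. -/
inductive PatchThy {S : Type*} (cov : S → Set S → Prop) (le : S → S → Prop) :
    Finset (PatchGen S) → Set (Finset (PatchGen S)) → Prop where
  | R1 : PatchThy cov le ∅ {B | ∃ a : S, B = {PatchGen.r a}}
  | R2 (a b : S) :
      PatchThy cov le {PatchGen.r a, PatchGen.r b}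
        {B | ∃ c ∈ down le {a} {b}, B = {PatchGen.r c}}
  | R3 (a : S) (A : Finset S) :
      cov a ↑A → PatchThy cov le {PatchGen.r a} {B | ∃ b ∈ A, B = {PatchGen.r b}}
  | R4 (a : S) :
      PatchThy cov le {PatchGen.r a} {B | ∃ b : S, wb cov b a ∧ B = {PatchGen.r b}}
  | L1 : PatchThy cov le ∅ {({PatchGen.l ∅} : Finset (PatchGen S))}
  | L2 (A B : Finset S) :
      covS cov ↑A ↑B →
      PatchThy cov le {PatchGen.l B} {({PatchGen.l A} : Finset (PatchGen S))}
  | L3 (A B : Finset S) :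
      PatchThy cov le {PatchGen.l A, PatchGen.l B}
        {D | ∃ C : Finset S, wbS cov ↑A ↑C ∧ wbS cov ↑B ↑C ∧ D = {PatchGen.l C}}
  | Loc (a b : S) :
      wb cov a b →
      PatchThy cov le ∅
        {({PatchGen.l {a}} : Finset (PatchGen S)), ({PatchGen.r b} : Finset (PatchGen S))}
  | D (a : S) :
      PatchThy cov le {PatchGen.l {a}, PatchGen.r a} (∅ : Set (Finset (PatchGen S)))

/-- the cover of `Patch(S)`. -/
def patchCov {S : Type*} (cov : S → Set S → Prop) (le : S → S → Prop) :
    Finset (PatchGen S) → Set (Finset (PatchGen S)) → Prop :=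
  GCov (PatchThy cov le)

/-- the counit `ε_P : Patch(S) → S`. -/
def epsP {S : Type*} (cov : S → Set S → Prop) (le : S → S → Prop) :
    Finset (PatchGen S) → S → Prop :=
  fun 𝔄 a => patchCov cov le 𝔄 {({PatchGen.r a} : Finset (PatchGen S))}

/-- The geometric theory `T_L` presenting the Lawson topology of a continuous
basic cover (the axioms of `T_P` without (R1), (R2)). -/
inductive LawsonThy {S : Type*} (cov : S → Set S → Prop) :
    Finset (PatchGen S) → Set (Finset (PatchGen S)) → Prop where
  | R3 (a : S) (A : Finset S) :
      cov a ↑A → LawsonThy cov {PatchGen.r a} {B | ∃ b ∈ A, B = {PatchGen.r b}}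
  | R4 (a : S) :
      LawsonThy cov {PatchGen.r a} {B | ∃ b : S, wb cov b a ∧ B = {PatchGen.r b}}
  | L1 : LawsonThy cov ∅ {({PatchGen.l ∅} : Finset (PatchGen S))}
  | L2 (A B : Finset S) :
      covS cov ↑A ↑B →
      LawsonThy cov {PatchGen.l B} {({PatchGen.l A} : Finset (PatchGen S))}
  | L3 (A B : Finset S) :
      LawsonThy cov {PatchGen.l A, PatchGen.l B}
        {D | ∃ C : Finset S, wbS cov ↑A ↑C ∧ wbS cov ↑B ↑C ∧ D = {PatchGen.l C}}
  | Loc (a b : S) :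
      wb cov a b →
      LawsonThy cov ∅
        {({PatchGen.l {a}} : Finset (PatchGen S)), ({PatchGen.r b} : Finset (PatchGen S))}
  | D (a : S) :
      LawsonThy cov {PatchGen.l {a}, PatchGen.r a} (∅ : Set (Finset (PatchGen S)))

/-- the cover of the Lawson topology `L(S)`. -/
def lawsonCov {S : Type*} (cov : S → Set S → Prop) :
    Finset (PatchGen S) → Set (Finset (PatchGen S)) → Prop :=
  GCov (LawsonThy cov)

/-- the counit `ε_L : L(S) → S`. -/
def epsL {S : Type*} (cov : S → Set S → Prop) : Finset (PatchGen S) → S → Prop :=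
  fun 𝔄 a => lawsonCov cov 𝔄 {({PatchGen.r a} : Finset (PatchGen S))}

/-- The theory presenting the lower powerlocale of a continuous basic cover:
generators `a ∈ S`, axioms (R3) and (R4). -/
inductive LowerThy {S : Type*} (cov : S → Set S → Prop) :
    Finset S → Set (Finset S) → Prop where
  | R3 (a : S) (A : Finset S) :
      cov a ↑A → LowerThy cov {a} {B | ∃ b ∈ A, B = ({b} : Finset S)}
  | R4 (a : S) :
      LowerThy cov {a} {B | ∃ b : S, wb cov b a ∧ B = ({b} : Finset S)}

/-- the cover of the lower powerlocale `Lower(S)`. -/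
def lowerCov {S : Type*} (cov : S → Set S → Prop) :
    Finset S → Set (Finset S) → Prop :=
  GCov (LowerThy cov)

/-- the counit `σ_L : Lower(S) → S`. -/
def sigmaL {S : Type*} (cov : S → Set S → Prop) : Finset S → S → Prop :=
  fun A a => lowerCov cov A ({({a} : Finset S)} : Set (Finset S))

/-! ### de Groot duals -/

/-- `↟A = {B ∈ Fin S | A ≪ B}`. -/
def upF {S : Type*} (cov : S → Set S → Prop) (A : Finset S) : Set (Finset S) :=
  {B | wbS cov ↑A ↑B}

/-- the finite join `⋁^F {↟A | A ∈ 𝒜}` of Scott open filters. -/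
def finJoin {S : Type*} (cov : S → Set S → Prop) (le : S → S → Prop)
    (𝒜 : Finset (Finset S)) : Set (Finset S) :=
  if 𝒜 = ∅ then {B | covS cov Set.univ ↑B}
  else {B | ∃ g : Finset S → Finset S,
    (∀ A ∈ 𝒜, wbS cov ↑A ↑(g A)) ∧
    wbS cov {c | ∀ A ∈ 𝒜, ∃ b ∈ g A, le c b} ↑B}

/-- The cover `◁^D` of the de Groot dual `S^D`, inductively generated on
`(Fin S, ⊇)` by the axioms (D3) `A ◁ ↟A` and (D4). -/
inductive DCov {S : Type*} (cov : S → Set S → Prop) (le : S → S → Prop) :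
    Finset S → Set (Finset S) → Prop where
  | refl {A : Finset S} {𝒰 : Set (Finset S)} : A ∈ 𝒰 → DCov cov le A 𝒰
  | le {A B : Finset S} {𝒰 : Set (Finset S)} :
      B ⊆ A → DCov cov le B 𝒰 → DCov cov le A 𝒰
  | d3 {A A' : Finset S} {𝒰 : Set (Finset S)} :
      A ⊆ A' →
      (∀ C : Finset S, A' ⊆ C → (∃ B : Finset S, wbS cov ↑A ↑B ∧ B ⊆ C) →
        DCov cov le C 𝒰) →
      DCov cov le A' 𝒰
  | d4 {A A' : Finset S} {𝒜 : Finset (Finset S)} {𝒰 : Set (Finset S)} :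
      A ⊆ A' → upF cov A ⊆ finJoin cov le 𝒜 →
      (∀ C : Finset S, A' ⊆ C → (∃ B ∈ 𝒜, B ⊆ C) → DCov cov le C 𝒰) →
      DCov cov le A' 𝒰

/-- the cover of the Scott topology `Σ(S)` on `(Fin S, ⊇)`. -/
def scottCov {S : Type*} (cov : S → Set S → Prop) :
    Finset S → Set (Finset S) → Prop :=
  fun A 𝒰 => upF cov A ⊆ ⋃ B ∈ 𝒰, upF cov B

/-- a filter (with respect to `◁`) of basic opens, given by a set of finite subsets. -/
def IsCovFilter {S : Type*} (cov : S → Set S → Prop) (le : S → S → Prop)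
    (𝒱 : Set (Finset S)) : Prop :=
  𝒱.Nonempty ∧
  (∀ A ∈ 𝒱, ∀ B : Finset S, covS cov ↑A ↑B → B ∈ 𝒱) ∧
  (∀ A ∈ 𝒱, ∀ B ∈ 𝒱, ∃ C ∈ 𝒱, covS cov ↑C (down le ↑A ↑B))

/-- The geometric theory `T^d` presenting the de Groot dual `S^d`:
generators `l A` (identified with `A : Finset S`), axioms (L1)–(L3) and (D4). -/
inductive DGThy {S : Type*} (cov : S → Set S → Prop) (le : S → S → Prop) :
    Finset (Finset S) → Set (Finset (Finset S)) → Prop where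
  | L1 : DGThy cov le ∅ {({(∅ : Finset S)} : Finset (Finset S))}
  | L2 (A B : Finset S) :
      covS cov ↑A ↑B → DGThy cov le {B} {({A} : Finset (Finset S))}
  | L3 (A B : Finset S) :
      DGThy cov le {A, B}
        {D | ∃ C : Finset S, wbS cov ↑A ↑C ∧ wbS cov ↑B ↑C ∧ D = ({C} : Finset (Finset S))}
  | D4 (A : Finset S) (𝒜 : Finset (Finset S)) :
      upF cov A ⊆ finJoin cov le 𝒜 →
      DGThy cov le {A} {D | ∃ B ∈ 𝒜, D = ({B} : Finset (Finset S))}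

/-! ### Spectral formal topologies -/

/-- spectral formal topologies: a compatible meet-semilattice structure on the
base, with every basic element way-below itself. -/
def IsSpectral {S : Type*} (cov : S → Set S → Prop) (le : S → S → Prop)
    (one : S) (meet : S → S → S) : Prop :=
  (∀ a : S, cov a {one}) ∧
  (∀ a b : S, cov (meet a b) (down le {a} {b})) ∧
  (∀ a b : S, ∀ c ∈ down le {a} {b}, cov c {meet a b}) ∧
  (∀ a : S, wb cov a a)

/-! ### Subtopologies -/

/-- the property of being a formal-topology cover compatible with `le`. -/
def IsFTCover {S : Type*} (cov : S → Set S → Prop) (le : S → S → Prop) : Prop :=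
  IsBasicCover cov ∧ (∀ a b : S, le a b → cov a {b}) ∧
  (∀ (a : S) (U V : Set S), cov a U → cov a V → cov a (down le U V))

/-- The meet (in `SubTop(S)`) of a family of subtopology covers: the least
formal-topology cover containing all of them. -/
def covMeet {S : Type*} {ι : Sort*} (le : S → S → Prop)
    (F : ι → (S → Set S → Prop)) : S → Set S → Prop :=
  fun a U => ∀ c : S → Set S → Prop,
    IsFTCover c le → (∀ i : ι, ∀ (a' : S) (U' : Set S), F i a' U' → c a' U') → c a U

/-- the closed subtopology `C_a` determined by `{a}`. -/
def closedCov {S : Type*} (cov : S → Set S → Prop) (a : S) : S → Set S → Prop :=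
  fun c V => cov c ({a} ∪ V)

/-- the open subtopology `S_B` determined by a finite `B`. -/
def openCov {S : Type*} (cov : S → Set S → Prop) (le : S → S → Prop)
    (B : Finset S) : S → Set S → Prop :=
  fun c V => covS cov (down le {c} ↑B) V

/-- `K_A = ⋀_{A ≪ B} S_B`. -/
def KCov {S : Type*} (cov : S → Set S → Prop) (le : S → S → Prop) (A : Finset S) :
    S → Set S → Prop :=
  covMeet le (fun B : {B : Finset S // wbS cov ↑A ↑B} => openCov cov le B.1)

/-- `C_a ∨ K_A` (the join of subtopologies is the intersection of covers). -/
def CKCov {S : Type*} (cov : S → Set S → Prop) (le : S → S → Prop)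
    (a : S) (A : Finset S) : S → Set S → Prop :=
  fun c V => closedCov cov a c V ∧ KCov cov le A c V

/-- perfect subtopologies. -/
def IsPerfectSub {S : Type*} (cov : S → Set S → Prop) (le : S → S → Prop)
    (cov' : S → Set S → Prop) : Prop :=
  IsFTCover cov' le ∧ (∀ (a : S) (U : Set S), cov a U → cov' a U) ∧
  (∀ a b : S, wb cov a b → wb cov' a b)

/-- the order of `PSub(S)`: `(a,A) ≤ (b,B)` iff `C_b ∨ K_B ⊑ C_a ∨ K_A`. -/
def PSubLe {S : Type*} (cov : S → Set S → Prop) (le : S → S → Prop) :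
    S × Finset S → S × Finset S → Prop :=
  fun p q => ∀ (c : S) (V : Set S), CKCov cov le p.1 p.2 c V → CKCov cov le q.1 q.2 c V

/-- the cover of `PSub(S)`: `(a,A) ◁ U` iff `⋀{C_b ∨ K_B | (b,B) ∈ U} ⊑ C_a ∨ K_A`. -/
def covPSub {S : Type*} (cov : S → Set S → Prop) (le : S → S → Prop) :
    S × Finset S → Set (S × Finset S) → Prop :=
  fun p U => ∀ (c : S) (V : Set S), CKCov cov le p.1 p.2 c V →
    covMeet le (fun q : U => CKCov cov le q.1.1 q.1.2) c V

/-- the map `r : PSub(S) → Patch(S)` on generators. -/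
def rGenPS {S : Type*} (cov : S → Set S → Prop) (le : S → S → Prop)
    (p : S × Finset S) : PatchGen S → Prop
  | PatchGen.r b => covPSub cov le p {((b, (∅ : Finset S)) : S × Finset S)}
  | PatchGen.l B => covPSub cov le p {q : S × Finset S | q.2 = B}

/-- the map `r : PSub(S) → Patch(S)`, extended along the presentation. -/
def rPS {S : Type*} (cov : S → Set S → Prop) (le : S → S → Prop) :
    S × Finset S → Finset (PatchGen S) → Prop :=
  fun p 𝔅 => ∀ g ∈ 𝔅, covPSub cov le p (rinv (fun q g' => rGenPS cov le q g') {g})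

/-- the map `s : Patch(S) → PSub(S)`. -/
def sPS {S : Type*} (cov : S → Set S → Prop) (le : S → S → Prop) :
    Finset (PatchGen S) → (S × Finset S) → Prop :=
  fun 𝔄 p => patchCov cov le 𝔄
    ({({PatchGen.r p.1, PatchGen.l p.2} : Finset (PatchGen S))} : Set (Finset (PatchGen S)))

/-! ### Saturated subsets, dcpos and preframes -/

/-- the saturated subsets of a basic cover. -/
abbrev SatSet {α : Type*} (cov : α → Set α → Prop) : Type _ :=
  {U : Set α // ∀ a, cov a U → a ∈ U}

/-- the join of a family of saturated subsets. -/
def satSup {α : Type*} {cov : α → Set α → Prop} (hbc : IsBasicCover cov)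
    (D : Set (SatSet cov)) : SatSet cov :=
  ⟨{a | cov a (⋃ U ∈ D, (U : Set α))}, fun a h => hbc.2 a _ _ h (fun _ hb => hb)⟩

/-- inductively generated basic covers: `BGen Ax` is the cover generated by the
axiom-set with axioms `a ◁ C` for `C ∈ Ax a`. -/
inductive BGen {S : Type*} (Ax : S → Set (Set S)) : S → Set S → Prop where
  | refl {a : S} {U : Set S} : a ∈ U → BGen Ax a U
  | infty {a : S} {U : Set S} (C : Set S) :
      C ∈ Ax a → (∀ b ∈ C, BGen Ax b U) → BGen Ax a U

theorem BGen_trans {S : Type*} {Ax : S → Set (Set S)} {a : S} {U V : Set S}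
    (h : BGen Ax a U) (h' : ∀ b ∈ U, BGen Ax b V) : BGen Ax a V := by
  induction h with
  | refl ha => exact h' _ ha
  | infty C hC _ ih => exact BGen.infty C hC (fun b hb => ih b hb h')

theorem BGen_isBasicCover {S : Type*} (Ax : S → Set (Set S)) :
    IsBasicCover (BGen Ax) :=
  ⟨fun _ _ h => BGen.refl h, fun _ _ _ h h' => BGen_trans h h'⟩

/-- the lower powerlocale theory of an inductively generated basic cover. -/
inductive LowerThyAx {S : Type*} (Ax : S → Set (Set S)) :
    Finset S → Set (Finset S) → Prop where
  | mk (a : S) (C : Set S) :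
      C ∈ Ax a → LowerThyAx Ax {a} {B | ∃ b ∈ C, B = ({b} : Finset S)}

/-- the counit `σ_L : Lower(S) → S` for an inductively generated basic cover. -/
def sigmaLAx {S : Type*} (Ax : S → Set (Set S)) : Finset S → S → Prop :=
  fun A a => GCov (LowerThyAx Ax) A ({({a} : Finset S)} : Set (Finset S))

/-- the top saturated subset of a presented topology. -/
def satTop {P : Type*} (T : Finset P → Set (Finset P) → Prop) : SatSet (GCov T) :=
  ⟨Set.univ, fun _ _ => Set.mem_univ _⟩

/-- binary meets of saturated subsets of a presented topology. -/
def satInfL {P : Type*} (T : Finset P → Set (Finset P) → Prop)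
    (U V : SatSet (GCov T)) : SatSet (GCov T) :=
  ⟨{A | GCov T A (down supord (U : Set (Finset P)) (V : Set (Finset P)))},
   fun _ h => GCov_trans h (fun _ hB => hB)⟩

/-- the suplattice homomorphism `σ_L* : Sat(S) → Sat(Lower(S))`. -/
def sigmaStar {S : Type*} (Ax : S → Set (Set S)) (U : SatSet (BGen Ax)) :
    SatSet (GCov (LowerThyAx Ax)) :=
  ⟨{A : Finset S | GCov (LowerThyAx Ax) A (rinv (sigmaLAx Ax) (U : Set S))},
   fun _ h => GCov_trans h (fun _ hB => hB)⟩

/-- a preframe structure on a partial order: finite meets and directed joins,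
with finite meets distributing over directed joins. -/
structure PreframeStr (X : Type*) [PartialOrder X] where
  top : X
  inf : X → X → X
  dSup : Set X → X
  le_top : ∀ x, x ≤ top
  inf_le_left : ∀ x y, inf x y ≤ x
  inf_le_right : ∀ x y, inf x y ≤ y
  le_inf : ∀ x y z, x ≤ y → x ≤ z → x ≤ inf y z
  le_dSup : ∀ d : Set X, d.Nonempty → DirectedOn (· ≤ ·) d → ∀ x ∈ d, x ≤ dSup d
  dSup_le : ∀ d : Set X, d.Nonempty → DirectedOn (· ≤ ·) d →
    ∀ z, (∀ x ∈ d, x ≤ z) → dSup d ≤ z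
  distrib : ∀ (x : X) (d : Set X), d.Nonempty → DirectedOn (· ≤ ·) d →
    inf x (dSup d) = dSup ((fun y => inf x y) '' d)

/-- dcpo homomorphisms out of `Sat(S)`. -/
def IsDcpoHom {α : Type*} {cov : α → Set α → Prop} (hbc : IsBasicCover cov)
    {X : Type*} [PartialOrder X] (PF : PreframeStr X) (f : SatSet cov → X) : Prop :=
  Monotone f ∧
  ∀ D : Set (SatSet cov), D.Nonempty → DirectedOn (· ≤ ·) D →
    f (satSup hbc D) = PF.dSup (f '' D)

/-- preframe homomorphisms out of the frame of a presented topology. -/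
def IsPreframeHomL {P : Type*} (T : Finset P → Set (Finset P) → Prop)
    {X : Type*} [PartialOrder X] (PF : PreframeStr X)
    (F : SatSet (GCov T) → X) : Prop :=
  Monotone F ∧ F (satTop T) = PF.top ∧
  (∀ U V, F (satInfL T U V) = PF.inf (F U) (F V)) ∧
  ∀ D : Set (SatSet (GCov T)), D.Nonempty → DirectedOn (· ≤ ·) D →
    F (satSup (GCov_isBasicCover T) D) = PF.dSup (F '' D)

/-! ### Located subsets: auxiliary notions -/

/-- the lower part `L_V` associated to a located subset `V`. -/
def LV {S : Type*} (cov : S → Set S → Prop) (V : Set S) : Set S :=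
  {a | ∃ A : Finset S, wbS cov {a} ↑A ∧ (↑A ∩ V : Set S) = ∅}

/-- cuts of a continuous basic cover. -/
def IsCut {S : Type*} (cov : S → Set S → Prop) (L U : Set S) : Prop :=
  (∀ (a : S) (A : Finset S), cov a ↑A → a ∈ U → ((↑A : Set S) ∩ U).Nonempty) ∧
  (∀ a ∈ U, ∃ b : S, wb cov b a ∧ b ∈ U) ∧
  (∀ (a : S) (A : Finset S), cov a ↑A → (↑A : Set S) ⊆ L → a ∈ L) ∧
  (∀ a ∈ L, ∃ A : Finset S, wbS cov {a} ↑A ∧ (↑A : Set S) ⊆ L) ∧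
  (∀ a b : S, wb cov a b → a ∈ L ∨ b ∈ U) ∧
  L ∩ U = ∅

end FTP

namespace FTP

/-! ### Continuous basic covers -/

section BasicCover

variable {S : Type*} {cov : S → Set S → Prop}

theorem IsBasicCover.mono (hbc : IsBasicCover cov) {a : S} {U V : Set S}
    (h : cov a U) (hUV : U ⊆ V) : cov a V :=
  hbc.2 a U V h fun b hb => hbc.1 b V (hUV hb)

theorem IsBasicCover.covS_of_subset (hbc : IsBasicCover cov) {U V : Set S} (h : U ⊆ V) :
    covS cov U V :=
  fun a ha => hbc.1 a V (h ha)

theorem IsBasicCover.covS_trans (hbc : IsBasicCover cov) {U V W : Set S}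
    (h : covS cov U V) (h' : covS cov V W) : covS cov U W :=
  fun a ha => hbc.2 a V W (h a ha) h'

theorem wbS_mono (hbc : IsBasicCover cov) {U U' V V' : Set S}
    (hU : covS cov U' U) (h : wbS cov U V) (hV : covS cov V V') : wbS cov U' V' := by
  intro W hW
  obtain ⟨W₀, h₀, h₁⟩ := h W (hbc.covS_trans hV hW)
  exact ⟨W₀, h₀, hbc.covS_trans hU h₁⟩

theorem covS_of_wbS (hbc : IsBasicCover cov) {U V : Set S} (h : wbS cov U V) : covS cov U V := by
  obtain ⟨W₀, h₀, h₁⟩ := h V (hbc.covS_of_subset subset_rfl)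
  exact hbc.covS_trans h₁ (hbc.covS_of_subset h₀)

theorem wbS_singleton {a b : S} : wbS cov {a} {b} ↔ wb cov a b := by
  constructor
  · intro h U hU
    obtain ⟨W₀, h₀, h₁⟩ := h U (by rintro _ rfl; exact hU)
    exact ⟨W₀, h₀, h₁ a rfl⟩
  · intro h U hU
    obtain ⟨W₀, h₀, h₁⟩ := h U (hU b rfl)
    exact ⟨W₀, h₀, by rintro _ rfl; exact h₁⟩

/-- The way-below relation on a finite set can be checked elementwise. -/
theorem wbS_of_forall_mem (hbc : IsBasicCover cov) (A : Finset S) {U : Set S}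
    (h : ∀ a ∈ A, wbS cov {a} U) : wbS cov ↑A U := by
  intro W hW
  choose! f hf hf' using fun a ha => h a ha W hW
  refine ⟨A.biUnion f, ?_, ?_⟩
  · intro x hx
    obtain ⟨a, ha, hx⟩ := Finset.mem_biUnion.1 hx
    exact hf a ha hx
  · intro a ha
    refine hbc.mono (hf' a ha a rfl) fun x hx => ?_
    exact Finset.mem_biUnion.2 ⟨a, ha, hx⟩

theorem wbS_of_forall_wb (hbc : IsBasicCover cov) (A : Finset S) {U : Set S}
    (h : ∀ a ∈ A, ∃ b ∈ U, wb cov a b) : wbS cov ↑A U := by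
  refine wbS_of_forall_mem hbc A fun a ha => ?_
  obtain ⟨b, hb, hab⟩ := h a ha
  exact wbS_mono hbc (hbc.covS_of_subset subset_rfl) (wbS_singleton.2 hab)
    (hbc.covS_of_subset (Set.singleton_subset_iff.2 hb))

theorem wbS_union (hbc : IsBasicCover cov) {A B : Finset S} {U : Set S}
    (hA : wbS cov ↑A U) (hB : wbS cov ↑B U) : wbS cov ↑(A ∪ B) U := by
  refine wbS_of_forall_mem hbc _ fun a ha => ?_
  rcases Finset.mem_union.1 ha with h | h
  · exact wbS_mono hbc (hbc.covS_of_subset (Set.singleton_subset_iff.2 h)) hA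
      (hbc.covS_of_subset subset_rfl)
  · exact wbS_mono hbc (hbc.covS_of_subset (Set.singleton_subset_iff.2 h)) hB
      (hbc.covS_of_subset subset_rfl)

variable {w : S → Set S}

theorem wbS_exists_wb (hbc : IsBasicCover cov) (hw : IsContinuous cov w) {V U : Set S}
    (h : wbS cov V U) :
    ∃ K : Finset S, covS cov V ↑K ∧ ∀ k ∈ K, ∃ u ∈ U, wb cov k u := by
  obtain ⟨K, h₀, h₁⟩ := h {k | ∃ u ∈ U, wb cov k u} fun u hu =>
    hbc.mono (hw.2 u) fun k hk => ⟨u, hu, hw.1 u k hk⟩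
  exact ⟨K, h₁, fun k hk => h₀ hk⟩

theorem wbS_exists_subset (hbc : IsBasicCover cov) (hw : IsContinuous cov w) {V U : Set S}
    (h : wbS cov V U) : ∃ H : Finset S, ↑H ⊆ U ∧ wbS cov V ↑H := by
  obtain ⟨K, hK, hKU⟩ := wbS_exists_wb hbc hw h
  choose! f hf hf' using hKU
  refine ⟨K.image f, ?_, wbS_mono hbc hK (wbS_of_forall_wb hbc K (U := ↑(K.image f)) ?_)
    (hbc.covS_of_subset subset_rfl)⟩
  · intro x hx
    obtain ⟨k, hk, rfl⟩ := Finset.mem_image.1 hx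
    exact hf k hk
  · exact fun k hk => ⟨f k, Finset.mem_coe.2 (Finset.mem_image_of_mem f hk), hf' k hk⟩

/-- Interpolation, with the interpolant elementwise way-below the upper bound. -/
theorem wbS_interpolate (hbc : IsBasicCover cov) (hw : IsContinuous cov w) {V U : Set S}
    (h : wbS cov V U) :
    ∃ K : Finset S, wbS cov V ↑K ∧ ∀ k ∈ K, ∃ u ∈ U, wb cov k u := by
  obtain ⟨H, hVH, hH⟩ := wbS_exists_wb hbc hw h
  have hV : wbS cov V {k | ∃ u ∈ U, wb cov k u} := by
    intro W hW
    refine h W fun u hu => hbc.2 u _ _ (hw.2 u) fun k hk => hW k ⟨u, hu, hw.1 u k hk⟩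
  obtain ⟨K, hK, hVK⟩ := wbS_exists_subset hbc hw hV
  exact ⟨K, hVK, fun k hk => hK hk⟩

theorem wbS_interpolate' (hbc : IsBasicCover cov) (hw : IsContinuous cov w) {V U : Set S}
    (h : wbS cov V U) : ∃ K : Finset S, wbS cov V ↑K ∧ wbS cov ↑K U := by
  obtain ⟨K, hVK, hK⟩ := wbS_interpolate hbc hw h
  exact ⟨K, hVK, wbS_of_forall_wb hbc K hK⟩

theorem wbS_saturation (hbc : IsBasicCover cov) {V U : Set S}
    (h : wbS cov V {x | cov x U}) : wbS cov V U :=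
  wbS_mono hbc (hbc.covS_of_subset subset_rfl) h fun _ hx => hx

end BasicCover

/-! ### Derivations from geometric theories -/

section GCov

variable {P Q : Type*} {T : Finset P → Set (Finset P) → Prop}
  {T' : Finset Q → Set (Finset Q) → Prop}

theorem GCov_use {A x : Finset P} {𝒞 𝒰 : Set (Finset P)} (hT : T A 𝒞) (hA : A ⊆ x)
    (h : ∀ y, x ⊆ y → (∃ D ∈ 𝒞, D ⊆ y) → GCov T y 𝒰) : GCov T x 𝒰 := by
  have := GCov.ax (𝒰 := 𝒰) x hT fun B hB =>
    h (x ∪ B) Finset.subset_union_left ⟨B, hB, Finset.subset_union_right⟩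
  rwa [Finset.union_eq_left.2 hA] at this

theorem GCov_mono {x : Finset P} {𝒰 𝒱 : Set (Finset P)} (h : GCov T x 𝒰) (h' : 𝒰 ⊆ 𝒱) :
    GCov T x 𝒱 :=
  GCov_trans h fun _ hB => GCov.refl (h' hB)

theorem GCov_localize {A : Finset P} {𝒰 : Set (Finset P)} (h : GCov T A 𝒰) :
    ∀ x, A ⊆ x → GCov T x {y | x ⊆ y ∧ ∃ B ∈ 𝒰, B ⊆ y} := by
  induction h with
  | refl hA => exact fun x hx => GCov.refl ⟨subset_rfl, _, hA, hx⟩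
  | le hBA _ ih => exact fun x hx => ih x (hBA.trans hx)
  | ax C hT _ ih =>
    intro x hx
    refine GCov_use hT (Finset.union_subset_right hx) fun y hxy ⟨D, hD, hDy⟩ => ?_
    exact GCov_mono (ih D hD y (Finset.union_subset ((Finset.union_subset_left hx).trans hxy) hDy))
      fun z hz => ⟨hxy.trans hz.1, hz.2⟩

/-- Cut, keeping the context. -/
theorem GCov_cut {x : Finset P} {𝒰 𝒱 : Set (Finset P)} (h : GCov T x 𝒰)
    (h' : ∀ y, x ⊆ y → (∃ B ∈ 𝒰, B ⊆ y) → GCov T y 𝒱) : GCov T x 𝒱 :=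
  GCov_trans (GCov_localize h x subset_rfl) fun y hy => h' y hy.1 hy.2

theorem GCov_forall {ι : Type*} (s : Finset ι) (Φ : ι → Finset P → Prop)
    (hΦ : ∀ i y z, y ⊆ z → Φ i y → Φ i z) (x : Finset P)
    (h : ∀ i ∈ s, GCov T x {y | Φ i y}) : GCov T x {y | x ⊆ y ∧ ∀ i ∈ s, Φ i y} := by
  induction s using Finset.induction_on with
  | empty => exact GCov.refl ⟨subset_rfl, by simp⟩
  | insert i s _ ih =>
    refine GCov_cut (ih fun j hj => h j (Finset.mem_insert_of_mem hj)) ?_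
    rintro y hxy ⟨B, ⟨-, hB⟩, hBy⟩
    refine GCov_cut (GCov.le hxy (h i (Finset.mem_insert_self i s))) ?_
    rintro z hyz ⟨D, hD, hDz⟩
    refine GCov.refl ⟨hxy.trans hyz, fun j hj => ?_⟩
    rcases Finset.mem_insert.1 hj with rfl | hj
    · exact hΦ _ _ _ hDz hD
    · exact hΦ _ _ _ (hBy.trans hyz) (hB j hj)

/-- The relation induced by an interpretation of the generators `Q` as opens of `GCov T`. -/
def interpRel (T : Finset P → Set (Finset P) → Prop) (φ : Q → Finset P → Prop) :
    Finset P → Finset Q → Prop :=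
  fun x B => ∀ q ∈ B, GCov T x {y | φ q y}

variable {φ : Q → Finset P → Prop} {ψ : P → Finset Q → Prop}

theorem interpRel_cut (hup : ∀ q y z, y ⊆ z → φ q y → φ q z) {x : Finset P} {B : Finset Q}
    (h : interpRel T φ x B) {𝒱 : Set (Finset P)}
    (h' : ∀ y, x ⊆ y → (∀ q ∈ B, φ q y) → GCov T y 𝒱) : GCov T x 𝒱 :=
  GCov_trans (GCov_forall B φ hup x h) fun y hy => h' y hy.1 hy.2

theorem interpRel_cov (hup : ∀ q y z, y ⊆ z → φ q y → φ q z)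
    (hax : ∀ A 𝒞, T' A 𝒞 → ∀ x, (∀ q ∈ A, φ q x) →
      GCov T x {y | ∃ B ∈ 𝒞, ∀ q ∈ B, φ q y})
    {A : Finset Q} {𝒰 : Set (Finset Q)} (h : GCov T' A 𝒰) :
    ∀ x, interpRel T φ x A → GCov T x (rinv (interpRel T φ) 𝒰) := by
  induction h with
  | refl hA => exact fun x hx => GCov.refl ⟨_, hA, hx⟩
  | le hBA _ ih => exact fun x hx => ih x fun q hq => hx q (hBA hq)
  | ax C hT _ ih =>
    intro x hx
    refine interpRel_cut hup (fun q hq => hx q (Finset.mem_union_right _ hq)) fun y hxy hy => ?_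
    refine GCov_cut (hax _ _ hT y hy) ?_
    rintro z hyz ⟨D, ⟨B, hB, hBD⟩, hDz⟩
    refine ih B hB z fun q hq => ?_
    rcases Finset.mem_union.1 hq with hq | hq
    · exact GCov.le (hxy.trans hyz) (hx q (Finset.mem_union_left _ hq))
    · exact GCov.refl (hup _ _ _ hDz (hBD q hq))

theorem interpRel_isFTM (hup : ∀ q y z, y ⊆ z → φ q y → φ q z)
    (hax : ∀ A 𝒞, T' A 𝒞 → ∀ x, (∀ q ∈ A, φ q x) →
      GCov T x {y | ∃ B ∈ 𝒞, ∀ q ∈ B, φ q y}) :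
    IsFTM (GCov T) supord (GCov T') supord (interpRel T φ) := by
  refine ⟨?_, ?_, ?_⟩
  · rintro _ 𝒰 h x ⟨A, rfl, hx⟩
    exact interpRel_cov hup hax h x hx
  · exact fun x _ => GCov.refl ⟨∅, trivial, by simp [interpRel]⟩
  · rintro _ _ x ⟨y, ⟨A, rfl, hy⟩, z, ⟨B, rfl, hz⟩, hxy, hxz⟩
    refine GCov.refl ⟨A ∪ B, ⟨A, rfl, B, rfl, Finset.subset_union_left,
      Finset.subset_union_right⟩, fun q hq => ?_⟩
    rcases Finset.mem_union.1 hq with hq | hq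
    · exact GCov.le hxy (hy q hq)
    · exact GCov.le hxz (hz q hq)

theorem interpRel_comp_eq (hφ : ∀ q y z, y ⊆ z → φ q y → φ q z)
    (hψ : ∀ p y z, y ⊆ z → ψ p y → ψ p z)
    (hax : ∀ A 𝒞, T' A 𝒞 → ∀ x, (∀ q ∈ A, φ q x) →
      GCov T x {y | ∃ B ∈ 𝒞, ∀ q ∈ B, φ q y})
    (hle : ∀ p c, ψ p c → ∀ y, (∀ q ∈ c, φ q y) → GCov T y {y | p ∈ y})
    (hge : ∀ p, GCov T {p} {y | ∃ c, ψ p c ∧ ∀ q ∈ c, φ q y}) :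
    MapEq (GCov T) (comp (interpRel T' ψ) (interpRel T φ)) (fun a b => a = b) := by
  constructor
  · rintro _ x ⟨A, rfl, B, hxB, hBA⟩
    refine GCov_trans (GCov_forall A (fun p y => p ∈ y) (fun _ _ _ h h' => h h') x
      fun p hp => ?_) fun y hy => GCov.le hy.2 (GCov.refl ⟨A, rfl, rfl⟩)
    refine GCov_trans (interpRel_cov hφ hax (hBA p hp) x hxB) ?_
    rintro y ⟨c, hc, hyc⟩
    exact interpRel_cut hφ hyc fun z _ hz => hle p c hc z hz
  · rintro _ x ⟨_, rfl, rfl⟩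
    refine GCov_trans (GCov_forall x (fun p y => ∃ c, ψ p c ∧ ∀ q ∈ c, φ q y)
      (fun p y z h ⟨c, hc, hy⟩ => ⟨c, hc, fun q hq => hφ _ _ _ h (hy q hq)⟩) x
      fun p hp => GCov.le (Finset.singleton_subset_iff.2 hp) (hge p)) ?_
    rintro y ⟨-, hy⟩
    choose! f hf hf' using hy
    refine GCov.refl ⟨x, rfl, x.biUnion f, fun q hq => ?_, fun p hp => ?_⟩
    · obtain ⟨p, hp, hq⟩ := Finset.mem_biUnion.1 hq
      exact GCov.refl (hf' p hp q hq)
    · exact GCov.refl (hψ _ _ _ (Finset.subset_biUnion_of_mem f hp) (hf p hp))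

/-- Mutually inverse interpretations of geometric theories induce an isomorphism of the
presented formal topologies. -/
theorem isIso_of_interp (hφ : ∀ q y z, y ⊆ z → φ q y → φ q z)
    (hψ : ∀ p y z, y ⊆ z → ψ p y → ψ p z)
    (haxφ : ∀ A 𝒞, T' A 𝒞 → ∀ x, (∀ q ∈ A, φ q x) →
      GCov T x {y | ∃ B ∈ 𝒞, ∀ q ∈ B, φ q y})
    (haxψ : ∀ A 𝒞, T A 𝒞 → ∀ x, (∀ p ∈ A, ψ p x) →
      GCov T' x {y | ∃ B ∈ 𝒞, ∀ p ∈ B, ψ p y})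
    (hleφ : ∀ p c, ψ p c → ∀ y, (∀ q ∈ c, φ q y) → GCov T y {y | p ∈ y})
    (hgeφ : ∀ p, GCov T {p} {y | ∃ c, ψ p c ∧ ∀ q ∈ c, φ q y})
    (hleψ : ∀ q c, φ q c → ∀ y, (∀ p ∈ c, ψ p y) → GCov T' y {y | q ∈ y})
    (hgeψ : ∀ q, GCov T' {q} {y | ∃ c, φ q c ∧ ∀ p ∈ c, ψ p y}) :
    IsIso (GCov T) supord (GCov T') supord :=
  ⟨interpRel T φ, interpRel T' ψ, interpRel_isFTM hφ haxφ, interpRel_isFTM hψ haxψ,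
    interpRel_comp_eq hφ hψ haxφ hleφ hgeφ, interpRel_comp_eq hψ hφ haxψ hleψ hgeψ⟩

end GCov

end FTP

namespace FTP

/-! ### Isomorphisms from a common space of points -/

theorem isFTM_of_ext {α β X : Type*} {cov : α → Set α → Prop} {le : α → α → Prop}
    {cov' : β → Set β → Prop} {le' : β → β → Prop} {e : α → X → Prop} {e' : β → X → Prop}
    (hcov : ∀ a U, cov a U ↔ ∀ x, e a x → ∃ b ∈ U, e b x)
    (hcov' : ∀ a U, cov' a U ↔ ∀ x, e' a x → ∃ b ∈ U, e' b x)
    (hle : ∀ a b, le a b → ∀ x, e a x → e b x)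
    (hdown' : ∀ a b x, e' a x → e' b x → ∃ c ∈ down le' {a} {b}, e' c x)
    (hsub : ∀ a x, e a x → ∃ b, e' b x ∧ ∀ y, e' b y → e a y)
    (hsub' : ∀ b x, e' b x → ∃ a, e a x ∧ ∀ y, e a y → e' b y) :
    IsFTM cov le cov' le' (fun a b => ∀ x, e a x → e' b x) ∧
      MapEq cov (comp (fun b a => ∀ x, e' b x → e a x) (fun a b => ∀ x, e a x → e' b x))
        (fun a b => a = b) := by
  refine ⟨⟨?_, ?_, ?_⟩, ?_, ?_⟩
  · rintro _ U hU a ⟨b, rfl, hab⟩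
    refine (hcov _ _).2 fun x hx => ?_
    obtain ⟨c, hc, hcx⟩ := (hcov' _ _).1 hU x (hab x hx)
    obtain ⟨d, hd, hdc⟩ := hsub' c x hcx
    exact ⟨d, ⟨c, hc, hdc⟩, hd⟩
  · refine fun a _ => (hcov _ _).2 fun x hx => ?_
    obtain ⟨c, hcx, -⟩ := hsub a x hx
    obtain ⟨d, hd, hdc⟩ := hsub' c x hcx
    exact ⟨d, ⟨c, trivial, hdc⟩, hd⟩
  · rintro _ _ z ⟨c, ⟨a, rfl, hca⟩, d, ⟨b, rfl, hdb⟩, hzc, hzd⟩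
    refine (hcov _ _).2 fun x hx => ?_
    obtain ⟨u, hu, hux⟩ := hdown' a b x (hca x (hle _ _ hzc x hx)) (hdb x (hle _ _ hzd x hx))
    obtain ⟨v, hv, hvu⟩ := hsub' u x hux
    exact ⟨v, ⟨u, hu, hvu⟩, hv⟩
  · rintro _ z ⟨a, rfl, b, hzb, hba⟩
    exact (hcov _ _).2 fun x hx => ⟨a, ⟨a, rfl, rfl⟩, hba x (hzb x hx)⟩
  · rintro _ z ⟨_, rfl, rfl⟩
    refine (hcov _ _).2 fun x hx => ?_
    obtain ⟨b, hb, hbz⟩ := hsub z x hx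
    obtain ⟨c, hc, hcb⟩ := hsub' b x hb
    exact ⟨c, ⟨z, rfl, b, hcb, hbz⟩, hc⟩

theorem isIso_of_ext {α β X : Type*} {cov : α → Set α → Prop} {le : α → α → Prop}
    {cov' : β → Set β → Prop} {le' : β → β → Prop} (e : α → X → Prop) (e' : β → X → Prop)
    (hcov : ∀ a U, cov a U ↔ ∀ x, e a x → ∃ b ∈ U, e b x)
    (hcov' : ∀ a U, cov' a U ↔ ∀ x, e' a x → ∃ b ∈ U, e' b x)
    (hle : ∀ a b, le a b → ∀ x, e a x → e b x)
    (hle' : ∀ a b, le' a b → ∀ x, e' a x → e' b x)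
    (hdown : ∀ a b x, e a x → e b x → ∃ c ∈ down le {a} {b}, e c x)
    (hdown' : ∀ a b x, e' a x → e' b x → ∃ c ∈ down le' {a} {b}, e' c x)
    (hsub : ∀ a x, e a x → ∃ b, e' b x ∧ ∀ y, e' b y → e a y)
    (hsub' : ∀ b x, e' b x → ∃ a, e a x ∧ ∀ y, e a y → e' b y) :
    IsIso cov le cov' le' := by
  obtain ⟨h₁, h₂⟩ := isFTM_of_ext hcov hcov' hle hdown' hsub hsub'
  obtain ⟨h₃, h₄⟩ := isFTM_of_ext hcov' hcov hle' hdown hsub' hsub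
  exact ⟨_, _, h₁, h₃, h₂, h₄⟩

/-! ### The lower powerlocale -/

/-- Compactness of the powerset: a finitary consequence of meeting every member of a family of
finite sets already follows from meeting finitely many of them. -/
theorem exists_finset_hitting {S : Type*} (𝒰 : Set (Finset S)) (R : Finset S → Prop)
    (h : ∀ U : Set S, (∀ B ∈ 𝒰, ∃ b ∈ B, b ∈ U) → ∃ H : Finset S, ↑H ⊆ U ∧ R H) :
    ∃ 𝒰₀ : Finset (Finset S), ↑𝒰₀ ⊆ 𝒰 ∧
      ∀ U : Set S, (∀ B ∈ 𝒰₀, ∃ b ∈ B, b ∈ U) → ∃ H : Finset S, ↑H ⊆ U ∧ R H := by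
  have hev : ∀ s : S, Continuous fun f : S → Bool => f s := fun s => continuous_apply s
  have hcl : ∀ s b, IsClosed {f : S → Bool | f s = b} := fun s b =>
    isClosed_singleton.preimage (hev s)
  have hop : ∀ s b, IsOpen {f : S → Bool | f s = b} := fun s b =>
    (isOpen_discrete {b}).preimage (hev s)
  let K : Set (S → Bool) := {f | ∀ H : Finset S, R H → ∃ s ∈ H, f s = false}
  have hK : IsClosed K := by
    have : K = ⋂ H : Finset S, ⋂ _ : R H, ⋃ s ∈ H, {f | f s = false} := by
      ext f; simp [K]
    rw [this]
    exact isClosed_iInter fun H => isClosed_iInter fun _ =>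
      H.finite_toSet.isClosed_biUnion fun s _ => hcl s false
  let t : 𝒰 → Set (S → Bool) := fun B => {f | ∃ s ∈ B.1, f s = true}
  have ht : ∀ B, IsClosed (t B) := by
    intro B
    have : t B = ⋃ s ∈ B.1, {f | f s = true} := by ext f; simp [t]
    rw [this]
    exact B.1.finite_toSet.isClosed_biUnion fun s _ => hcl s true
  obtain ⟨u, hu⟩ := hK.isCompact.elim_finite_subfamily_closed t ht (by
    rw [Set.eq_empty_iff_forall_notMem]
    rintro f ⟨hf, hft⟩
    obtain ⟨H, hH, hRH⟩ := h {s | f s = true} fun B hB => Set.mem_iInter.1 hft ⟨B, hB⟩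
    obtain ⟨s, hs, hfs⟩ := hf H hRH
    have := hH hs
    simp_all)
  refine ⟨u.image Subtype.val, ?_, fun U hU => ?_⟩
  · intro B hB
    obtain ⟨B, -, rfl⟩ := Finset.mem_image.1 (Finset.mem_coe.1 hB)
    exact B.2
  · by_contra! hc
    have : (fun s => decide (s ∈ U)) ∈ K ∩ ⋂ i ∈ u, t i := by
      refine ⟨fun H hRH => ?_, Set.mem_iInter₂.2 fun B hB => ?_⟩
      · by_contra! hH
        exact hc H (fun s hs => by simpa using hH s hs) hRH
      · obtain ⟨b, hb, hbU⟩ := hU B.1 (Finset.mem_image_of_mem _ hB)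
        exact ⟨b, hb, by simpa using hbU⟩
    rw [hu] at this
    exact this

section Lower

variable {S : Type*} {cov : S → Set S → Prop} {w : S → Set S}

/-- Points of the lower powerlocale are complements of saturated subsets, and there are enough
of them. -/
theorem lowerCov_iff (hbc : IsBasicCover cov) (hw : IsContinuous cov w) (A : Finset S)
    (𝒰 : Set (Finset S)) :
    lowerCov cov A 𝒰 ↔
      ∀ U : Set S, (∀ B ∈ 𝒰, ∃ b ∈ B, b ∈ U) → ∃ a ∈ A, cov a U := by
  constructor
  · intro h U
    induction h with
    | refl hA =>
      intro hU
      obtain ⟨b, hb, hbU⟩ := hU _ hA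
      exact ⟨b, hb, hbc.1 b U hbU⟩
    | le hBA _ ih =>
      intro hU
      obtain ⟨b, hb, hbU⟩ := ih hU
      exact ⟨b, hBA hb, hbU⟩
    | @ax A 𝒞 𝒰 C hT _ ih =>
      intro hU
      by_cases hC : ∃ c ∈ C, cov c U
      · obtain ⟨c, hc, hcU⟩ := hC
        exact ⟨c, Finset.mem_union_left _ hc, hcU⟩
      have ih' : ∀ b : S, {b} ∈ 𝒞 → cov b U := by
        intro b hb
        obtain ⟨x, hx, hxU⟩ := ih {b} hb hU
        rcases Finset.mem_union.1 hx with hx | hx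
        · exact absurd ⟨x, hx, hxU⟩ hC
        · rwa [Finset.mem_singleton.1 hx] at hxU
      cases hT with
      | R3 a A hA =>
        refine ⟨a, Finset.mem_union_right _ (Finset.mem_singleton_self a), ?_⟩
        exact hbc.2 a _ U hA fun b hb => ih' b ⟨b, hb, rfl⟩
      | R4 a =>
        refine ⟨a, Finset.mem_union_right _ (Finset.mem_singleton_self a), ?_⟩
        exact hbc.2 a _ U (hw.2 a) fun b hb => ih' b ⟨b, hw.1 a b hb, rfl⟩
  · intro h
    have h₁ : GCov (LowerThy cov) A {y | A ⊆ y ∧ ∀ a ∈ A, ∃ b ∈ y, wb cov b a} := by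
      refine GCov_forall A (fun a y => ∃ b ∈ y, wb cov b a)
        (fun a y z hyz ⟨b, hb, hba⟩ => ⟨b, hyz hb, hba⟩) A fun a ha => ?_
      refine GCov_use (LowerThy.R4 a) (Finset.singleton_subset_iff.2 ha) ?_
      rintro y - ⟨_, ⟨b, hb, rfl⟩, hby⟩
      exact GCov.refl ⟨b, Finset.singleton_subset_iff.1 hby, hb⟩
    refine GCov_trans h₁ fun A' ⟨_, hA'⟩ => ?_
    obtain ⟨𝒰₀, h𝒰₀, hfin⟩ := exists_finset_hitting 𝒰 (fun H => ∃ a ∈ A', cov a ↑H) (by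
      intro U hU
      obtain ⟨a, ha, haU⟩ := h U hU
      obtain ⟨b, hb, hba⟩ := hA' a ha
      obtain ⟨H, hH, hbH⟩ := hba U haU
      exact ⟨H, hH, b, hb, hbH⟩)
    let ℋ : Finset (Finset S) := (𝒰₀.biUnion id).powerset.filter fun H => ∃ a ∈ A', cov a ↑H
    have h₂ : GCov (LowerThy cov) A' {y | A' ⊆ y ∧ ∀ H ∈ ℋ, ∃ x ∈ H, x ∈ y} := by
      refine GCov_forall ℋ (fun H y => ∃ x ∈ H, x ∈ y)
        (fun H y z hyz ⟨b, hb, hba⟩ => ⟨b, hb, hyz hba⟩) A' fun H hH => ?_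
      obtain ⟨a, ha, haH⟩ := (Finset.mem_filter.1 hH).2
      refine GCov_use (LowerThy.R3 a H haH) (Finset.singleton_subset_iff.2 ha) ?_
      rintro y - ⟨_, ⟨b, hb, rfl⟩, hby⟩
      exact GCov.refl ⟨b, hb, Finset.singleton_subset_iff.1 hby⟩
    refine GCov_trans h₂ fun y ⟨_, hy⟩ => ?_
    by_cases hB : ∃ B ∈ 𝒰₀, B ⊆ y
    · obtain ⟨B, hB, hBy⟩ := hB
      exact GCov.le hBy (GCov.refl (h𝒰₀ hB))
    · exfalso
      obtain ⟨H, hH, hR⟩ := hfin {x | x ∈ 𝒰₀.biUnion id ∧ x ∉ y} fun B hB' => by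
        obtain ⟨b, hb, hby⟩ := Finset.not_subset.1 fun h => hB ⟨B, hB', h⟩
        exact ⟨b, hb, Finset.mem_biUnion.2 ⟨B, hB', hb⟩, hby⟩
      obtain ⟨x, hx, hxy⟩ := hy H
        (Finset.mem_filter.2 ⟨Finset.mem_powerset.2 fun x hx => (hH hx).1, hR⟩)
      exact (hH hx).2 hxy

/-- `U` is a point of the extent of `⋁ {r(A) | A ∈ 𝒱}` in the de Groot dual. -/
def dualExt (cov : S → Set S → Prop) (𝒱 : Set (Finset S)) (U : Set S) : Prop :=
  ∃ G : Finset S, wbS cov ↑G U ∧ ∀ A ∈ 𝒱, ∃ a ∈ A, cov a ↑G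

theorem dualExt_mono (hbc : IsBasicCover cov) {𝒱 : Set (Finset S)} {U U' : Set S}
    (h : dualExt cov 𝒱 U) (hU : covS cov U U') : dualExt cov 𝒱 U' := by
  obtain ⟨G, hG, h⟩ := h
  exact ⟨G, wbS_mono hbc (hbc.covS_of_subset subset_rfl) hG hU, h⟩

theorem dualExt_anti {𝒱 𝒱' : Set (Finset S)} {U : Set S}
    (h : dualExt cov 𝒱 U) (h𝒱 : 𝒱' ⊆ 𝒱) : dualExt cov 𝒱' U := by
  obtain ⟨G, hG, h⟩ := h
  exact ⟨G, hG, fun A hA => h A (h𝒱 hA)⟩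

theorem dualExt_union (hbc : IsBasicCover cov) {𝒱 𝒱' : Set (Finset S)} {U : Set S}
    (h : dualExt cov 𝒱 U) (h' : dualExt cov 𝒱' U) : dualExt cov (𝒱 ∪ 𝒱') U := by
  obtain ⟨G, hG, h⟩ := h
  obtain ⟨G', hG', h'⟩ := h'
  refine ⟨G ∪ G', wbS_union hbc hG hG', ?_⟩
  rintro A (hA | hA)
  · obtain ⟨a, ha, haG⟩ := h A hA
    exact ⟨a, ha, hbc.mono haG (by simp)⟩
  · obtain ⟨a, ha, haG⟩ := h' A hA
    exact ⟨a, ha, hbc.mono haG (by simp)⟩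

theorem dualExt_interpolate (hbc : IsBasicCover cov) (hw : IsContinuous cov w)
    {𝒱 : Set (Finset S)} {U : Set S} (h : dualExt cov 𝒱 U) :
    ∃ H : Finset S, dualExt cov 𝒱 ↑H ∧ wbS cov ↑H U := by
  obtain ⟨G, hG, h⟩ := h
  obtain ⟨H, hGH, hHU⟩ := wbS_interpolate' hbc hw hG
  exact ⟨H, ⟨G, hGH, h⟩, hHU⟩

theorem wbS_lower_iff (hbc : IsBasicCover cov) (hw : IsContinuous cov w)
    {𝒱 ℬ : Set (Finset S)} :
    wbS (lowerCov cov) 𝒱 ℬ ↔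
      ∀ U : Set S, (∀ B ∈ ℬ, ∃ b ∈ B, b ∈ U) → dualExt cov 𝒱 U := by
  constructor
  · intro h U hU
    obtain ⟨𝒰₀, h𝒰₀, h𝒱⟩ := h {y | ∃ B ∈ ℬ, ∀ b ∈ B, ∃ c ∈ y, wb cov c b} (by
      intro B hB
      refine (lowerCov_iff hbc hw _ _).2 fun V hV => ?_
      by_contra! hc
      have : ∀ b ∈ B, ∃ c, wb cov c b ∧ ¬ cov c V := by
        intro b hb
        by_contra! hb'
        exact hc b hb (hbc.2 b _ V (hw.2 b) fun c hc => hb' c (hw.1 b c hc))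
      choose! f hf hf' using this
      obtain ⟨c, hc, hcV⟩ := hV (B.image f)
        ⟨B, hB, fun b hb => ⟨f b, Finset.mem_image_of_mem f hb, hf b hb⟩⟩
      obtain ⟨b, hb, rfl⟩ := Finset.mem_image.1 hc
      exact hf' b hb (hbc.1 _ _ hcV))
    have : ∀ y ∈ 𝒰₀, ∃ c ∈ y, ∃ b ∈ U, wb cov c b := by
      intro y hy
      obtain ⟨B, hB, hBy⟩ := h𝒰₀ hy
      obtain ⟨b, hb, hbU⟩ := hU B hB
      obtain ⟨c, hc, hcb⟩ := hBy b hb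
      exact ⟨c, hc, b, hbU, hcb⟩
    choose f hf hf' using this
    refine ⟨𝒰₀.attach.image fun y => f y.1 y.2, wbS_of_forall_wb hbc _ fun c hc => ?_, fun A hA => ?_⟩
    · obtain ⟨⟨y, hy⟩, -, rfl⟩ := Finset.mem_image.1 hc
      exact hf' y hy
    · refine (lowerCov_iff hbc hw _ _).1 (h𝒱 A hA) _ fun y hy => ?_
      exact ⟨f y hy, hf y hy, Finset.mem_coe.2
        (Finset.mem_image_of_mem (fun y : 𝒰₀ => f y.1 y.2) (Finset.mem_attach 𝒰₀ ⟨y, hy⟩))⟩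
  · intro h 𝒲 h𝒲
    obtain ⟨𝒲₀, h₀, hfin⟩ := exists_finset_hitting 𝒲
      (fun H => ∀ A ∈ 𝒱, ∃ a ∈ A, cov a ↑H) (by
        intro U hU
        obtain ⟨G, hG, hGA⟩ := h {x | cov x U} fun B hB =>
          (lowerCov_iff hbc hw _ _).1 (h𝒲 B hB) U hU
        obtain ⟨H, hH, hGH⟩ := wbS_saturation hbc hG U (hbc.covS_of_subset subset_rfl)
        refine ⟨H, hH, fun A hA => ?_⟩
        obtain ⟨a, ha, haG⟩ := hGA A hA
        exact ⟨a, ha, hbc.2 a _ _ haG hGH⟩)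
    refine ⟨𝒲₀, h₀, fun A hA => (lowerCov_iff hbc hw _ _).2 fun U hU => ?_⟩
    obtain ⟨H, hH, hHA⟩ := hfin U hU
    obtain ⟨a, ha, haH⟩ := hHA A hA
    exact ⟨a, ha, hbc.mono haH hH⟩

theorem dualExt_of_wbS (hbc : IsBasicCover cov) (hw : IsContinuous cov w)
    {𝒱 ℬ : Set (Finset S)} (h : wbS (lowerCov cov) 𝒱 ℬ) {U : Set S} (hU : dualExt cov ℬ U) :
    dualExt cov 𝒱 U := by
  obtain ⟨G, hG, hGB⟩ := hU
  exact dualExt_mono hbc ((wbS_lower_iff hbc hw).1 h {x | cov x ↑G} hGB)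
    (hbc.covS_trans (fun _ h => h) (covS_of_wbS hbc hG))

/-- Every point in the extent of `𝒱` lies in the extent of some finite `ℬ ≫ 𝒱`. -/
theorem dualExt_exists_wbS (hbc : IsBasicCover cov) (hw : IsContinuous cov w)
    {𝒱 : Set (Finset S)} {U : Set S} (h : dualExt cov 𝒱 U) :
    ∃ ℬ : Finset (Finset S), wbS (lowerCov cov) 𝒱 ↑ℬ ∧ dualExt cov ↑ℬ U := by
  obtain ⟨H, hH, hHU⟩ := dualExt_interpolate hbc hw h
  refine ⟨H.image fun h => {h}, (wbS_lower_iff hbc hw).2 fun V hV => ?_, H, hHU, ?_⟩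
  · refine dualExt_mono hbc hH (hbc.covS_of_subset fun h hh => ?_)
    obtain ⟨b, hb, hbV⟩ := hV {h} (Finset.mem_coe.2 (Finset.mem_image_of_mem _ hh))
    rwa [← Finset.mem_singleton.1 hb]
  · intro A hA
    obtain ⟨h, hh, rfl⟩ := Finset.mem_image.1 (Finset.mem_coe.1 hA)
    exact ⟨h, Finset.mem_singleton_self h, hbc.1 _ _ hh⟩

theorem mem_finJoin_iff (hbc : IsBasicCover cov) (hw : IsContinuous cov w)
    (𝔸 : Finset (Finset (Finset S))) (ℬ : Finset (Finset S)) :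
    ℬ ∈ finJoin (lowerCov cov) supord 𝔸 ↔
      ∀ U : Set S, (∀ B ∈ ℬ, ∃ b ∈ B, b ∈ U) → ∃ 𝒜 ∈ 𝔸, dualExt cov ↑𝒜 U := by
  unfold finJoin
  split_ifs with h𝔸
  · subst h𝔸
    constructor
    · intro h U hU
      obtain ⟨a, ha, -⟩ := (lowerCov_iff hbc hw _ _).1 (h ∅ trivial) U hU
      simp at ha
    · intro h A _
      refine (lowerCov_iff hbc hw _ _).2 fun U hU => ?_
      obtain ⟨𝒜, h𝒜, -⟩ := h U hU
      simp at h𝒜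
  constructor
  · rintro ⟨g, hg, hgB⟩ U hU
    obtain ⟨G, hG, hGc⟩ := (wbS_lower_iff hbc hw).1 hgB U hU
    by_contra! hc
    have : ∀ 𝒜 ∈ 𝔸, ∃ b ∈ g 𝒜, ∀ x ∈ b, ¬ cov x ↑G := by
      intro 𝒜 h𝒜
      by_contra! hb
      exact hc 𝒜 h𝒜 (dualExt_of_wbS hbc hw (hg 𝒜 h𝒜) ⟨G, hG, hb⟩)
    choose! f hf hf' using this
    obtain ⟨x, hx, hxG⟩ := hGc (𝔸.biUnion f) fun 𝒜 h𝒜 =>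
      ⟨f 𝒜, hf 𝒜 h𝒜, Finset.subset_biUnion_of_mem f h𝒜⟩
    obtain ⟨𝒜, h𝒜, hx⟩ := Finset.mem_biUnion.1 hx
    exact hf' 𝒜 h𝒜 x hx hxG
  · intro h
    let ℋ : Finset (Finset S) := (ℬ.biUnion id).powerset.filter fun H : Finset S => ∀ B ∈ ℬ, ∃ b ∈ B, b ∈ H
    have hℋ : ∀ H ∈ ℋ, ∃ 𝒜 ∈ 𝔸, ∃ K : Finset S, dualExt cov ↑𝒜 ↑K ∧ wbS cov ↑K ↑H := by
      intro H hH
      obtain ⟨𝒜, h𝒜, hd⟩ := h ↑H (Finset.mem_filter.1 hH).2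
      obtain ⟨K, hK⟩ := dualExt_interpolate hbc hw hd
      exact ⟨𝒜, h𝒜, K, hK⟩
    choose! i hi K hK hKH using hℋ
    let 𝒦 : Finset (Finset S) → Finset (Finset S) := fun 𝒜 => ℋ.filter fun H => i H = 𝒜
    let g : Finset (Finset S) → Finset (Finset S) := fun 𝒜 =>
      ((𝒦 𝒜).biUnion K).powerset.filter fun y => ∀ H ∈ 𝒦 𝒜, ∃ k ∈ K H, k ∈ y
    refine ⟨g, fun 𝒜 h𝒜 => ?_, ?_⟩
    · refine (wbS_lower_iff hbc hw).2 fun U hU => ?_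
      have : ∃ H ∈ 𝒦 𝒜, ↑(K H) ⊆ U := by
        by_contra! hc
        obtain ⟨b, hb, hbU⟩ := hU (((𝒦 𝒜).biUnion K).filter fun x => x ∉ U) (by
          refine Finset.mem_coe.2 (Finset.mem_filter.2
            ⟨Finset.mem_powerset.2 (Finset.filter_subset _ _), fun H hH => ?_⟩)
          obtain ⟨k, hk, hkU⟩ := Set.not_subset.1 (hc H hH)
          exact ⟨k, hk, Finset.mem_filter.2 ⟨Finset.mem_biUnion.2 ⟨H, hH, hk⟩, hkU⟩⟩)
        exact (Finset.mem_filter.1 hb).2 hbU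
      obtain ⟨H, hH, hHU⟩ := this
      obtain ⟨hHℋ, rfl⟩ := Finset.mem_filter.1 hH
      exact dualExt_mono hbc (hK H hHℋ) (hbc.covS_of_subset hHU)
    · refine (wbS_lower_iff hbc hw).2 fun U hU => ?_
      let H := (ℬ.biUnion id).filter fun x => x ∈ U
      have hH : H ∈ ℋ := by
        refine Finset.mem_filter.2 ⟨Finset.mem_powerset.2 (Finset.filter_subset _ _),
          fun B hB => ?_⟩
        obtain ⟨b, hb, hbU⟩ := hU B hB
        exact ⟨b, hb, Finset.mem_filter.2 ⟨Finset.mem_biUnion.2 ⟨B, hB, hb⟩, hbU⟩⟩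
      refine ⟨K H, wbS_mono hbc (hbc.covS_of_subset subset_rfl) (hKH H hH)
        (hbc.covS_of_subset fun x hx => (Finset.mem_filter.1 hx).2), fun c hc => ?_⟩
      obtain ⟨b, hb, hbc'⟩ := hc (i H) (hi H hH)
      obtain ⟨k, hk, hkb⟩ := (Finset.mem_filter.1 hb).2 H (Finset.mem_filter.2 ⟨hH, rfl⟩)
      exact ⟨k, hbc' hkb, hbc.1 _ _ hk⟩

theorem DCov_lower_iff (hbc : IsBasicCover cov) (hw : IsContinuous cov w)
    (𝒜 : Finset (Finset S)) (𝔘 : Set (Finset (Finset S))) :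
    DCov (lowerCov cov) supord 𝒜 𝔘 ↔
      ∀ U : Set S, dualExt cov ↑𝒜 U → ∃ ℬ ∈ 𝔘, dualExt cov ↑ℬ U := by
  constructor
  · intro h U
    have hun : ∀ {A B : Finset (Finset S)}, dualExt cov ↑A U → dualExt cov ↑B U →
        dualExt cov ↑(A ∪ B) U := by
      intro A B hA hB
      exact dualExt_anti (dualExt_union hbc hA hB) (by simp)
    induction h with
    | refl hA => exact fun hU => ⟨_, hA, hU⟩
    | le hBA _ ih => exact fun hU => ih (dualExt_anti hU (Finset.coe_subset.2 hBA))
    | d3 hA _ ih =>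
      intro hU
      obtain ⟨B, hB, hBU⟩ := dualExt_exists_wbS hbc hw (dualExt_anti hU (Finset.coe_subset.2 hA))
      exact ih _ Finset.subset_union_left ⟨B, hB, Finset.subset_union_right⟩ (hun hU hBU)
    | d4 hA hF _ ih =>
      intro hU
      obtain ⟨ℬ, hℬ, G, hG, hGB⟩ :=
        dualExt_exists_wbS hbc hw (dualExt_anti hU (Finset.coe_subset.2 hA))
      obtain ⟨B, hB, hBU⟩ := (mem_finJoin_iff hbc hw _ _).1 (hF hℬ) {x | cov x ↑G} hGB
      have hBU' := dualExt_mono hbc hBU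
        (hbc.covS_trans (fun _ h => h) (covS_of_wbS hbc hG))
      exact ih _ Finset.subset_union_left ⟨B, hB, Finset.subset_union_right⟩ (hun hU hBU')
  · intro h
    refine DCov.d3 subset_rfl ?_
    rintro 𝒞' - ⟨𝒞, h𝒜𝒞, h𝒞⟩
    have h𝒞U : ∀ U : Set S, (∀ B ∈ 𝒞, ∃ b ∈ B, b ∈ U) → ∃ ℬ ∈ 𝔘, dualExt cov ↑ℬ U :=
      fun U hU => h U ((wbS_lower_iff hbc hw).1 h𝒜𝒞 U hU)
    let ℋ : Finset (Finset S) := (𝒞.biUnion id).powerset.filter fun H : Finset S => ∀ B ∈ 𝒞, ∃ b ∈ B, b ∈ H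
    have hℋ : ∀ H ∈ ℋ, ∃ ℬ ∈ 𝔘, dualExt cov ↑ℬ ↑H :=
      fun H hH => h𝒞U ↑H (Finset.mem_filter.1 hH).2
    choose! f hf hf' using hℋ
    refine DCov.d4 (𝒜 := ℋ.image f) h𝒞 ?_ ?_
    · intro ℬ hℬ
      refine (mem_finJoin_iff hbc hw _ _).2 fun U hU => ?_
      obtain ⟨G, hG, hGC⟩ := (wbS_lower_iff hbc hw).1 hℬ U hU
      let H := (𝒞.biUnion id).filter fun x => cov x ↑G
      have hH : H ∈ ℋ := by
        refine Finset.mem_filter.2 ⟨Finset.mem_powerset.2 (Finset.filter_subset _ _),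
          fun B hB => ?_⟩
        obtain ⟨b, hb, hbG⟩ := hGC B hB
        exact ⟨b, hb, Finset.mem_filter.2 ⟨Finset.mem_biUnion.2 ⟨B, hB, hb⟩, hbG⟩⟩
      exact ⟨f H, Finset.mem_image_of_mem f hH, dualExt_mono hbc (hf' H hH)
        (hbc.covS_trans (fun x hx => (Finset.mem_filter.1 hx).2) (covS_of_wbS hbc hG))⟩
    · rintro C - ⟨B, hB, hBC⟩
      obtain ⟨H, hH, rfl⟩ := Finset.mem_image.1 hB
      exact DCov.le hBC (DCov.refl (hf H hH))

theorem scottCov_iff (hbc : IsBasicCover cov) (hw : IsContinuous cov w) (A : Finset S)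
    (𝒰 : Set (Finset S)) :
    scottCov cov A 𝒰 ↔ ∀ U : Set S, wbS cov ↑A U → ∃ B ∈ 𝒰, wbS cov ↑B U := by
  constructor
  · intro h U hU
    obtain ⟨K, hAK, hKU⟩ := wbS_interpolate' hbc hw hU
    obtain ⟨B, hB, hBK⟩ := Set.mem_iUnion₂.1 (h hAK)
    exact ⟨B, hB, wbS_mono hbc (hbc.covS_of_subset subset_rfl) hBK (covS_of_wbS hbc hKU)⟩
  · intro h U hU
    obtain ⟨B, hB, hBU⟩ := h ↑U hU
    exact Set.mem_iUnion₂.2 ⟨B, hB, hBU⟩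

/-- The Scott topology is the de Groot dual of the lower powerlocale. -/
theorem scott_iso_dual_lower (hbc : IsBasicCover cov) (hw : IsContinuous cov w) :
    IsIso (scottCov cov) (supord : Finset S → Finset S → Prop)
      (DCov (lowerCov cov) supord)
      (supord : Finset (Finset S) → Finset (Finset S) → Prop) := by
  refine isIso_of_ext (X := Set S) (fun A U => wbS cov ↑A U) (fun 𝒜 U => dualExt cov ↑𝒜 U)
    (scottCov_iff hbc hw) (DCov_lower_iff hbc hw) ?_ ?_ ?_ ?_ ?_ ?_
  · exact fun A B hBA U hU => wbS_mono hbc (hbc.covS_of_subset (Finset.coe_subset.2 hBA)) hU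
      (hbc.covS_of_subset subset_rfl)
  · exact fun 𝒜 ℬ h U hU => dualExt_anti hU (Finset.coe_subset.2 h)
  · exact fun A B U hA hB => ⟨A ∪ B, ⟨A, rfl, B, rfl, Finset.subset_union_left,
      Finset.subset_union_right⟩, wbS_union hbc hA hB⟩
  · exact fun A B U hA hB => ⟨A ∪ B, ⟨A, rfl, B, rfl, Finset.subset_union_left,
      Finset.subset_union_right⟩, dualExt_anti (dualExt_union hbc hA hB) (by simp)⟩
  · intro A U hU
    refine ⟨A.image fun a => {a}, ⟨A, hU, ?_⟩, ?_⟩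
    · intro B hB
      obtain ⟨a, ha, rfl⟩ := Finset.mem_image.1 (Finset.mem_coe.1 hB)
      exact ⟨a, Finset.mem_singleton_self a, hbc.1 _ _ ha⟩
    · rintro V ⟨G, hG, hGA⟩
      refine wbS_mono hbc (fun a ha => ?_) hG (hbc.covS_of_subset subset_rfl)
      obtain ⟨b, hb, hbG⟩ := hGA {a} (Finset.mem_coe.2 (Finset.mem_image_of_mem _ ha))
      rwa [← Finset.mem_singleton.1 hb]
  · rintro 𝒜 U ⟨G, hG, hGA⟩
    exact ⟨G, hG, fun V hV => ⟨G, hV, hGA⟩⟩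

end Lower

end FTP

namespace FTP

/-! ### The Scott cover -/

section Scott

variable {S : Type*} {cov : S → Set S → Prop} {w : S → Set S}

theorem scottCov_isBasicCover : IsBasicCover (scottCov cov) := by
  refine ⟨fun A 𝒰 hA U hU => Set.mem_iUnion₂.2 ⟨A, hA, hU⟩, fun A 𝒰 𝒱 h h' U hU => ?_⟩
  obtain ⟨B, hB, hBU⟩ := Set.mem_iUnion₂.1 (h hU)
  exact h' B hB hBU

theorem scottCov_singleton (hbc : IsBasicCover cov) {A B : Finset S}
    (h : covS cov ↑B ↑A) : scottCov cov A {B} :=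
  fun _ hU => Set.mem_iUnion₂.2
    ⟨B, rfl, wbS_mono hbc h hU (hbc.covS_of_subset subset_rfl)⟩

theorem scott_wbS_exists (hbc : IsBasicCover cov) (hw : IsContinuous cov w)
    {𝒜 𝒞 : Set (Finset S)} (h : wbS (scottCov cov) 𝒜 𝒞) :
    ∃ 𝒢 : Finset (Finset S), (∀ G ∈ 𝒢, ∃ B ∈ 𝒞, wbS cov ↑B ↑G) ∧ covS (scottCov cov) 𝒜 ↑𝒢 := by
  obtain ⟨𝒢, h𝒢, h'⟩ := h {G | ∃ B ∈ 𝒞, wbS cov ↑B ↑G} fun B hB =>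
    (scottCov_iff hbc hw _ _).2 fun U hU => by
      obtain ⟨K, hBK, hKU⟩ := wbS_interpolate' hbc hw hU
      exact ⟨K, ⟨B, hB, hBK⟩, hKU⟩
  exact ⟨𝒢, fun G hG => h𝒢 hG, h'⟩

theorem scott_wb_exists (hbc : IsBasicCover cov) (hw : IsContinuous cov w)
    {A B : Finset S} (h : wb (scottCov cov) A B) :
    ∃ 𝒢 : Finset (Finset S), (∀ G ∈ 𝒢, wbS cov ↑B ↑G) ∧ scottCov cov A ↑𝒢 := by
  obtain ⟨𝒢, h𝒢, h'⟩ := scott_wbS_exists hbc hw (wbS_singleton.2 h)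
  exact ⟨𝒢, fun G hG => by obtain ⟨_, rfl, hB⟩ := h𝒢 G hG; exact hB, h' A rfl⟩

theorem scott_wbS_of_exists (hbc : IsBasicCover cov) {𝒜 𝒞 : Set (Finset S)}
    (𝒢 : Finset (Finset S)) (h𝒢 : ∀ G ∈ 𝒢, ∃ B ∈ 𝒞, wbS cov ↑B ↑G)
    (h : ∀ A ∈ 𝒜, ∀ U : Finset S, wbS cov ↑A ↑U → ∃ G ∈ 𝒢, covS cov ↑G ↑U) :
    wbS (scottCov cov) 𝒜 𝒞 := by
  intro 𝒲 h𝒲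
  have : ∀ G ∈ 𝒢, ∃ W ∈ 𝒲, wbS cov ↑W ↑G := by
    intro G hG
    obtain ⟨B, hB, hBG⟩ := h𝒢 G hG
    obtain ⟨W, hW, hWG⟩ := Set.mem_iUnion₂.1 (h𝒲 B hB hBG)
    exact ⟨W, hW, hWG⟩
  choose! f hf hf' using this
  refine ⟨𝒢.image f, fun W hW => ?_, fun A hA U hU => ?_⟩
  · obtain ⟨G, hG, rfl⟩ := Finset.mem_image.1 (Finset.mem_coe.1 hW)
    exact hf G hG
  · obtain ⟨G, hG, hGU⟩ := h A hA U hU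
    exact Set.mem_iUnion₂.2 ⟨f G, Finset.mem_coe.2 (Finset.mem_image_of_mem f hG),
      wbS_mono hbc (hbc.covS_of_subset subset_rfl) (hf' G hG) hGU⟩

theorem scott_wb_of_wbS (hbc : IsBasicCover cov) {A B : Finset S} (h : wbS cov ↑B ↑A) :
    wb (scottCov cov) A B := by
  refine wbS_singleton.1 (scott_wbS_of_exists hbc {A} ?_ ?_)
  · intro G hG
    rw [Finset.mem_singleton.1 hG]
    exact ⟨B, rfl, h⟩
  · rintro _ rfl U hU
    exact ⟨_, Finset.mem_singleton_self _, covS_of_wbS hbc hU⟩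

end Scott

/-! ### Derived rules of the Lawson theory -/

section Lawson

variable {S : Type*} {cov : S → Set S → Prop} {x : Finset (PatchGen S)}
  {𝒰 : Set (Finset (PatchGen S))}

theorem lawson_R4 {a : S} (ha : PatchGen.r a ∈ x)
    (k : ∀ y b, x ⊆ y → wb cov b a → PatchGen.r b ∈ y → GCov (LawsonThy cov) y 𝒰) :
    GCov (LawsonThy cov) x 𝒰 := by
  refine GCov_use (LawsonThy.R4 a) (Finset.singleton_subset_iff.2 ha) ?_
  rintro y hxy ⟨_, ⟨b, hb, rfl⟩, hby⟩
  exact k y b hxy hb (Finset.singleton_subset_iff.1 hby)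

theorem lawson_l_mono {A B : Finset S} (hB : PatchGen.l B ∈ x) (h : covS cov ↑A ↑B)
    (k : ∀ y, x ⊆ y → PatchGen.l A ∈ y → GCov (LawsonThy cov) y 𝒰) :
    GCov (LawsonThy cov) x 𝒰 := by
  refine GCov_use (LawsonThy.L2 A B h) (Finset.singleton_subset_iff.2 hB) ?_
  rintro y hxy ⟨_, rfl, hy⟩
  exact k y hxy (Finset.singleton_subset_iff.1 hy)

theorem lawson_L3 {A B : Finset S} (hA : PatchGen.l A ∈ x) (hB : PatchGen.l B ∈ x)
    (k : ∀ y (C : Finset S), x ⊆ y → wbS cov ↑A ↑C → wbS cov ↑B ↑C → PatchGen.l C ∈ y →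
      GCov (LawsonThy cov) y 𝒰) :
    GCov (LawsonThy cov) x 𝒰 := by
  refine GCov_use (LawsonThy.L3 A B) ?_ ?_
  · intro g hg
    rcases Finset.mem_insert.1 hg with rfl | hg
    · exact hA
    · rwa [Finset.mem_singleton.1 hg]
  · rintro y hxy ⟨_, ⟨C, hAC, hBC, rfl⟩, hy⟩
    exact k y C hxy hAC hBC (Finset.singleton_subset_iff.1 hy)

theorem lawson_Loc {a b : S} (h : wb cov a b)
    (k : ∀ y, x ⊆ y → PatchGen.l {a} ∈ y ∨ PatchGen.r b ∈ y → GCov (LawsonThy cov) y 𝒰) :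
    GCov (LawsonThy cov) x 𝒰 := by
  refine GCov_use (LawsonThy.Loc a b h) (Finset.empty_subset x) ?_
  rintro y hxy ⟨_, rfl | rfl, hy⟩
  · exact k y hxy (Or.inl (Finset.singleton_subset_iff.1 hy))
  · exact k y hxy (Or.inr (Finset.singleton_subset_iff.1 hy))

theorem lawson_bot {A : Finset S} {c : S} (hA : PatchGen.l A ∈ x) (hc : PatchGen.r c ∈ x)
    (h : cov c ↑A) : GCov (LawsonThy cov) x 𝒰 := by
  refine lawson_l_mono (A := {c}) hA ?_ fun y hxy hy => ?_
  · intro b hb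
    rwa [Finset.mem_singleton.1 (Finset.mem_coe.1 hb)]
  · refine GCov_use (LawsonThy.D c) ?_ ?_
    · intro g hg
      rcases Finset.mem_insert.1 hg with rfl | hg
      · exact hy
      · rw [Finset.mem_singleton.1 hg]
        exact hxy hc
    · rintro z - ⟨_, h, -⟩
      exact absurd h (Set.notMem_empty _)

/-- A finite set of generators `r c` that meets every point of `⋃_{A ∈ 𝒜} ↟A` contradicts
`l A` for `A ∈ 𝒜`. -/
theorem lawson_bot_of_hitting {A C : Finset S} (hA : PatchGen.l A ∈ x)
    (hC : ∀ c ∈ C, PatchGen.r c ∈ x)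
    (h : ∀ U : Finset S, wbS cov ↑A ↑U → ∃ c ∈ C, cov c ↑U) : GCov (LawsonThy cov) x 𝒰 := by
  refine lawson_L3 hA hA fun y U hxy hAU _ hU => ?_
  obtain ⟨c, hc, hcU⟩ := h U hAU
  exact lawson_bot hU (hxy (hC c hc)) hcU

theorem lawson_l_of_singletons (hbc : IsBasicCover cov) (K : Finset S) :
    ∀ x : Finset (PatchGen S), (∀ k ∈ K, PatchGen.l {k} ∈ x) →
    (∀ y, x ⊆ y → PatchGen.l K ∈ y → GCov (LawsonThy cov) y 𝒰) →
    GCov (LawsonThy cov) x 𝒰 := by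
  induction K using Finset.induction_on with
  | empty =>
    intro x _ k
    refine GCov_use LawsonThy.L1 (Finset.empty_subset x) ?_
    rintro y hxy ⟨_, rfl, hy⟩
    exact k y hxy (Finset.singleton_subset_iff.1 hy)
  | insert a K _ ih =>
    intro x hx k
    refine ih x (fun h hh => hx h (Finset.mem_insert_of_mem hh)) fun y hxy hy => ?_
    refine lawson_L3 (hxy (hx a (Finset.mem_insert_self a K))) hy fun z C hyz haC hKC hz => ?_
    refine lawson_l_mono (A := insert a K) hz (fun b hb => ?_)
      fun v hzv hv => k v (hxy.trans (hyz.trans hzv)) hv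
    rcases Finset.mem_insert.1 (Finset.mem_coe.1 hb) with rfl | hb
    · exact covS_of_wbS hbc haC _ (by simp)
    · exact covS_of_wbS hbc hKC _ hb

end Lawson

/-! ### Derived rules of the theory of the patch of the Scott topology -/

section PatchScott

variable {S : Type*} {cov : S → Set S → Prop} {w : S → Set S}
  {x : Finset (PatchGen (Finset S))} {𝒰 : Set (Finset (PatchGen (Finset S)))}

theorem patch_R3 {A : Finset S} {𝒜 : Finset (Finset S)} (hA : PatchGen.r A ∈ x)
    (h : scottCov cov A ↑𝒜)
    (k : ∀ y, x ⊆ y → ∀ B ∈ 𝒜, PatchGen.r B ∈ y → GCov (PatchThy (scottCov cov) supord) y 𝒰) :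
    GCov (PatchThy (scottCov cov) supord) x 𝒰 := by
  refine GCov_use (PatchThy.R3 A 𝒜 h) (Finset.singleton_subset_iff.2 hA) ?_
  rintro y hxy ⟨_, ⟨B, hB, rfl⟩, hy⟩
  exact k y hxy B hB (Finset.singleton_subset_iff.1 hy)

theorem patch_r_mono (hbc : IsBasicCover cov) {A B : Finset S} (hA : PatchGen.r A ∈ x)
    (h : covS cov ↑B ↑A)
    (k : ∀ y, x ⊆ y → PatchGen.r B ∈ y → GCov (PatchThy (scottCov cov) supord) y 𝒰) :
    GCov (PatchThy (scottCov cov) supord) x 𝒰 := by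
  refine patch_R3 (𝒜 := {B}) hA (by simpa using scottCov_singleton hbc h) fun y hxy C hC hy => ?_
  rw [Finset.mem_singleton.1 hC] at hy
  exact k y hxy hy

theorem patch_R2 {A B : Finset S} (hA : PatchGen.r A ∈ x) (hB : PatchGen.r B ∈ x)
    (k : ∀ y C, x ⊆ y → A ⊆ C → B ⊆ C → PatchGen.r C ∈ y →
      GCov (PatchThy (scottCov cov) supord) y 𝒰) :
    GCov (PatchThy (scottCov cov) supord) x 𝒰 := by
  refine GCov_use (PatchThy.R2 A B) ?_ ?_
  · intro g hg
    rcases Finset.mem_insert.1 hg with rfl | hg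
    · exact hA
    · rwa [Finset.mem_singleton.1 hg]
  · rintro y hxy ⟨_, ⟨C, ⟨_, rfl, _, rfl, hAC, hBC⟩, rfl⟩, hy⟩
    exact k y C hxy hAC hBC (Finset.singleton_subset_iff.1 hy)

theorem patch_r_empty (hbc : IsBasicCover cov)
    (k : ∀ y, x ⊆ y → PatchGen.r ∅ ∈ y → GCov (PatchThy (scottCov cov) supord) y 𝒰) :
    GCov (PatchThy (scottCov cov) supord) x 𝒰 := by
  refine GCov_use PatchThy.R1 (Finset.empty_subset x) ?_
  rintro y hxy ⟨_, ⟨A, rfl⟩, hy⟩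
  exact patch_r_mono hbc (B := ∅) (Finset.singleton_subset_iff.1 hy)
    (hbc.covS_of_subset (by simp)) fun z hyz hz => k z (hxy.trans hyz) hz

theorem patch_r_of_singletons (hbc : IsBasicCover cov) (H : Finset S) :
    ∀ x : Finset (PatchGen (Finset S)), (∀ h ∈ H, PatchGen.r {h} ∈ x) →
    (∀ y, x ⊆ y → PatchGen.r H ∈ y → GCov (PatchThy (scottCov cov) supord) y 𝒰) →
    GCov (PatchThy (scottCov cov) supord) x 𝒰 := by
  induction H using Finset.induction_on with
  | empty => exact fun x _ k => patch_r_empty hbc k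
  | insert a H _ ih =>
    intro x hx k
    refine ih x (fun h hh => hx h (Finset.mem_insert_of_mem hh)) fun y hxy hy => ?_
    refine patch_R2 (hxy (hx a (Finset.mem_insert_self a H))) hy fun z C hyz haC hHC hz => ?_
    refine patch_r_mono hbc (B := insert a H) hz (hbc.covS_of_subset (Finset.coe_subset.2 ?_))
      fun v hzv hv => k v (hxy.trans (hyz.trans hzv)) hv
    exact Finset.insert_subset (Finset.singleton_subset_iff.1 haC) hHC

theorem patch_l_mono {𝒜 ℬ : Finset (Finset S)} (hB : PatchGen.l ℬ ∈ x)
    (h : covS (scottCov cov) ↑𝒜 ↑ℬ)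
    (k : ∀ y, x ⊆ y → PatchGen.l 𝒜 ∈ y → GCov (PatchThy (scottCov cov) supord) y 𝒰) :
    GCov (PatchThy (scottCov cov) supord) x 𝒰 := by
  refine GCov_use (PatchThy.L2 𝒜 ℬ h) (Finset.singleton_subset_iff.2 hB) ?_
  rintro y hxy ⟨_, rfl, hy⟩
  exact k y hxy (Finset.singleton_subset_iff.1 hy)

theorem patch_L3 {𝒜 ℬ : Finset (Finset S)} (hA : PatchGen.l 𝒜 ∈ x) (hB : PatchGen.l ℬ ∈ x)
    (k : ∀ y (𝒞 : Finset (Finset S)), x ⊆ y → wbS (scottCov cov) ↑𝒜 ↑𝒞 →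
      wbS (scottCov cov) ↑ℬ ↑𝒞 → PatchGen.l 𝒞 ∈ y →
      GCov (PatchThy (scottCov cov) supord) y 𝒰) :
    GCov (PatchThy (scottCov cov) supord) x 𝒰 := by
  refine GCov_use (PatchThy.L3 𝒜 ℬ) ?_ ?_
  · intro g hg
    rcases Finset.mem_insert.1 hg with rfl | hg
    · exact hA
    · rwa [Finset.mem_singleton.1 hg]
  · rintro y hxy ⟨_, ⟨C, hAC, hBC, rfl⟩, hy⟩
    exact k y C hxy hAC hBC (Finset.singleton_subset_iff.1 hy)

theorem patch_bot {A : Finset S} (hl : PatchGen.l {A} ∈ x) (hr : PatchGen.r A ∈ x) :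
    GCov (PatchThy (scottCov cov) supord) x 𝒰 := by
  refine GCov_use (PatchThy.D A) ?_ ?_
  · intro g hg
    rcases Finset.mem_insert.1 hg with rfl | hg
    · exact hl
    · rwa [Finset.mem_singleton.1 hg]
  · rintro z - ⟨_, h, -⟩
    exact absurd h (Set.notMem_empty _)

theorem patch_l_singletons {C : Finset S} (f : S → S) :
    ∀ x : Finset (PatchGen (Finset S)), (∀ c ∈ C, PatchGen.l {{f c}} ∈ x) →
    (∀ y, x ⊆ y → PatchGen.l (C.image fun c => {f c}) ∈ y →
      GCov (PatchThy (scottCov cov) supord) y 𝒰) →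
    GCov (PatchThy (scottCov cov) supord) x 𝒰 := by
  induction C using Finset.induction_on with
  | empty =>
    intro x _ k
    refine GCov_use PatchThy.L1 (Finset.empty_subset x) ?_
    rintro y hxy ⟨_, rfl, hy⟩
    exact k y hxy (by simpa using hy)
  | insert a C _ ih =>
    intro x hx k
    refine ih x (fun c hc => hx c (Finset.mem_insert_of_mem hc)) fun y hxy hy => ?_
    refine patch_L3 (hxy (hx a (Finset.mem_insert_self a C))) hy
      fun z 𝒞 hyz h₁ h₂ hz => ?_
    refine patch_l_mono hz (fun B hB => ?_) fun v hzv hv => k v (hxy.trans (hyz.trans hzv)) hv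
    obtain ⟨c, hc, rfl⟩ := Finset.mem_image.1 (Finset.mem_coe.1 hB)
    rcases Finset.mem_insert.1 hc with rfl | hc
    · exact covS_of_wbS scottCov_isBasicCover h₁ _ (by simp)
    · exact covS_of_wbS scottCov_isBasicCover h₂ _
        (Finset.mem_coe.2 (Finset.mem_image_of_mem _ hc))

theorem patch_locate (hbc : IsBasicCover cov) (hw : IsContinuous cov w) {B : Finset S}
    {U : Set S} (h : wbS cov ↑B U)
    (k : ∀ y, x ⊆ y →
      (PatchGen.r B ∈ y ∨ ∃ b, (∃ u ∈ U, wb cov b u) ∧ PatchGen.l {{b}} ∈ y) →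
      GCov (PatchThy (scottCov cov) supord) y 𝒰) :
    GCov (PatchThy (scottCov cov) supord) x 𝒰 := by
  obtain ⟨K, hBK, hK⟩ := wbS_interpolate hbc hw h
  obtain ⟨H, hBH, hH⟩ := wbS_interpolate hbc hw hBK
  refine GCov_trans (GCov_forall H (fun h y => PatchGen.r {h} ∈ y ∨
    ∃ b, (∃ u ∈ U, wb cov b u) ∧ PatchGen.l {{b}} ∈ y) ?_ x ?_) ?_
  · rintro h y z hyz (hy | ⟨b, hb, hy⟩)
    · exact Or.inl (hyz hy)
    · exact Or.inr ⟨b, hb, hyz hy⟩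
  · intro h hh
    obtain ⟨b, hb, hhb⟩ := hH h hh
    have h_loc : wb (scottCov cov) {b} {h} :=
      scott_wb_of_wbS hbc (by simpa using wbS_singleton.2 hhb)
    refine GCov_use (PatchThy.Loc _ _ h_loc) (Finset.empty_subset x) ?_
    rintro y - ⟨_, rfl | rfl, hy⟩
    · exact GCov.refl (Or.inr ⟨b, hK b hb, Finset.singleton_subset_iff.1 hy⟩)
    · exact GCov.refl (Or.inl (Finset.singleton_subset_iff.1 hy))
  · rintro y ⟨hxy, hy⟩
    by_cases hb : ∃ b, (∃ u ∈ U, wb cov b u) ∧ PatchGen.l {{b}} ∈ y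
    · exact k y hxy (Or.inr hb)
    · refine patch_r_of_singletons hbc H y (fun h hh => (hy h hh).resolve_right hb)
        fun z hyz hz => ?_
      exact patch_r_mono hbc hz (covS_of_wbS hbc hBH)
        fun v hzv hv => k v (hxy.trans (hyz.trans hzv)) (Or.inl hv)

theorem patch_l_split (hbc : IsBasicCover cov) (hw : IsContinuous cov w) {B : Finset S}
    {U : Set S} (h : wbS cov ↑B U) (hB : PatchGen.l {B} ∈ x)
    (k : ∀ y b, x ⊆ y → (∃ u ∈ U, wb cov b u) → PatchGen.l {{b}} ∈ y →
      GCov (PatchThy (scottCov cov) supord) y 𝒰) :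
    GCov (PatchThy (scottCov cov) supord) x 𝒰 := by
  refine patch_locate hbc hw h fun y hxy hy => ?_
  rcases hy with hy | ⟨b, hb, hy⟩
  · exact patch_bot (hxy hB) hy
  · exact k y b hxy hb hy

end PatchScott

/-! ### The Lawson topology is the patch of the Scott topology -/

section Iso

variable {S : Type*} {cov : S → Set S → Prop} {w : S → Set S}

/-- Interpretation of the generators of the patch of the Scott topology in the Lawson topology. -/
def patchToLawson (cov : S → Set S → Prop) :
    PatchGen (Finset S) → Finset (PatchGen S) → Prop
  | PatchGen.r A, y => PatchGen.l A ∈ y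
  | PatchGen.l 𝒜, y => ∃ C : Finset S, (∀ c ∈ C, PatchGen.r c ∈ y) ∧
      ∀ A ∈ 𝒜, ∀ U : Finset S, wbS cov ↑A ↑U → ∃ c ∈ C, cov c ↑U

/-- Interpretation of the generators of the Lawson topology in the patch of the Scott topology. -/
def lawsonToPatch (cov : S → Set S → Prop) :
    PatchGen S → Finset (PatchGen (Finset S)) → Prop
  | PatchGen.r a, y => ∃ b, wb cov b a ∧ PatchGen.l {{b}} ∈ y
  | PatchGen.l A, y => PatchGen.r A ∈ y

theorem patchToLawson_mono (q : PatchGen (Finset S)) (y z : Finset (PatchGen S)) (hyz : y ⊆ z)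
    (h : patchToLawson cov q y) : patchToLawson cov q z := by
  cases q with
  | r A => exact hyz h
  | l 𝒜 =>
    obtain ⟨C, hC, h⟩ := h
    exact ⟨C, fun c hc => hyz (hC c hc), h⟩

theorem lawsonToPatch_mono (p : PatchGen S) (y z : Finset (PatchGen (Finset S))) (hyz : y ⊆ z)
    (h : lawsonToPatch cov p y) : lawsonToPatch cov p z := by
  cases p with
  | r a =>
    obtain ⟨b, hb, h⟩ := h
    exact ⟨b, hb, hyz h⟩
  | l A => exact hyz h

theorem patchToLawson_interp (hbc : IsBasicCover cov) (hw : IsContinuous cov w)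
    (A : Finset (PatchGen (Finset S))) (𝒞 : Set (Finset (PatchGen (Finset S))))
    (hT : PatchThy (scottCov cov) supord A 𝒞) (x : Finset (PatchGen S))
    (hx : ∀ q ∈ A, patchToLawson cov q x) :
    GCov (LawsonThy cov) x {y | ∃ B ∈ 𝒞, ∀ q ∈ B, patchToLawson cov q y} := by
  cases hT with
  | R1 =>
    refine GCov_use LawsonThy.L1 (Finset.empty_subset x) ?_
    rintro y - ⟨_, rfl, hy⟩
    exact GCov.refl ⟨_, ⟨∅, rfl⟩, by
      simpa [patchToLawson] using Finset.singleton_subset_iff.1 hy⟩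
  | R2 A B =>
    have hA : PatchGen.l A ∈ x := hx (PatchGen.r A) (by simp)
    have hB : PatchGen.l B ∈ x := hx (PatchGen.r B) (by simp)
    refine lawson_L3 hA hB fun y C hxy hAC hBC hC => ?_
    refine lawson_l_mono (A := A ∪ B) hC (covS_of_wbS hbc (wbS_union hbc hAC hBC))
      fun z _ hz => ?_
    exact GCov.refl ⟨_, ⟨A ∪ B, ⟨A, rfl, B, rfl, Finset.subset_union_left,
      Finset.subset_union_right⟩, rfl⟩, by simpa [patchToLawson] using hz⟩
  | R3 A 𝒜 h =>
    have hA : PatchGen.l A ∈ x := hx (PatchGen.r A) (by simp)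
    refine lawson_L3 hA hA fun y C hxy hAC _ hC => ?_
    obtain ⟨B, hB, hBC⟩ := Set.mem_iUnion₂.1 (h hAC)
    refine lawson_l_mono hC (covS_of_wbS hbc hBC) fun z _ hz => ?_
    exact GCov.refl ⟨_, ⟨B, hB, rfl⟩, by simpa [patchToLawson] using hz⟩
  | R4 A =>
    have hA : PatchGen.l A ∈ x := hx (PatchGen.r A) (by simp)
    refine lawson_L3 hA hA fun y C hxy hAC _ hC => ?_
    exact GCov.refl ⟨_, ⟨C, scott_wb_of_wbS hbc hAC, rfl⟩, by simpa [patchToLawson] using hC⟩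
  | L1 =>
    exact GCov.refl ⟨_, rfl, by simpa [patchToLawson] using ⟨∅, by simp⟩⟩
  | L2 𝒜 ℬ h =>
    obtain ⟨C, hC, hCB⟩ := hx (PatchGen.l ℬ) (by simp)
    refine GCov.refl ⟨_, rfl, fun q hq => ?_⟩
    rw [Finset.mem_singleton.1 hq]
    refine ⟨C, hC, fun A hA U hU => ?_⟩
    obtain ⟨B, hB, hBU⟩ := Set.mem_iUnion₂.1 (h A hA hU)
    exact hCB B hB U hBU
  | L3 𝒜 ℬ =>
    obtain ⟨C, hC, hCA⟩ := hx (PatchGen.l 𝒜) (by simp)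
    obtain ⟨D, hD, hDB⟩ := hx (PatchGen.l ℬ) (by simp)
    refine GCov_trans (GCov_forall (C ∪ D) (fun c y => ∃ e, wb cov e c ∧ PatchGen.r e ∈ y)
      (fun c y z hyz ⟨e, he, hy⟩ => ⟨e, he, hyz hy⟩) x fun c hc => ?_) ?_
    · refine lawson_R4 (a := c) ?_ fun y b _ hb hy => GCov.refl ⟨b, hb, hy⟩
      rcases Finset.mem_union.1 hc with hc | hc
      · exact hC c hc
      · exact hD c hc
    · rintro y ⟨-, hy⟩
      choose! f hf hfy using hy
      let 𝒟 : Finset (Finset S) := (C ∪ D).image fun c => {f c}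
      have key : ∀ (E : Finset S) (𝒱 : Finset (Finset S)), E ⊆ C ∪ D →
          (∀ A ∈ 𝒱, ∀ U : Finset S, wbS cov ↑A ↑U → ∃ c ∈ E, cov c ↑U) →
          wbS (scottCov cov) ↑𝒱 ↑𝒟 := by
        intro E 𝒱 hE h
        refine scott_wbS_of_exists hbc (E.image fun c => {c}) ?_ ?_
        · intro G hG
          obtain ⟨c, hc, rfl⟩ := Finset.mem_image.1 hG
          refine ⟨{f c}, Finset.mem_coe.2
            (Finset.mem_image_of_mem (fun c => ({f c} : Finset S)) (hE hc)), ?_⟩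
          simpa using wbS_singleton.2 (hf c (hE hc))
        · intro A hA U hU
          obtain ⟨c, hc, hcU⟩ := h A hA U hU
          exact ⟨{c}, Finset.mem_image_of_mem (fun c => ({c} : Finset S)) hc, by
            simpa [covS] using hcU⟩
      refine GCov.refl ⟨_, ⟨𝒟, key C 𝒜 Finset.subset_union_left hCA,
        key D ℬ Finset.subset_union_right hDB, rfl⟩, fun q hq => ?_⟩
      rw [Finset.mem_singleton.1 hq]
      refine ⟨(C ∪ D).image f, fun e he => ?_, fun A hA U hU => ?_⟩
      · obtain ⟨c, hc, rfl⟩ := Finset.mem_image.1 he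
        exact hfy c hc
      · obtain ⟨c, hc, rfl⟩ := Finset.mem_image.1 hA
        exact ⟨f c, Finset.mem_image_of_mem f hc, covS_of_wbS hbc hU _ (by simp)⟩
  | Loc A B h =>
    obtain ⟨𝒢, h𝒢, hA𝒢⟩ := scott_wb_exists hbc hw h
    refine GCov_trans (GCov_forall 𝒢 (fun G y => PatchGen.l B ∈ y ∨ ∃ g ∈ G, PatchGen.r g ∈ y)
      ?_ x fun G hG => ?_) ?_
    · rintro G y z hyz (hy | ⟨g, hg, hy⟩)
      · exact Or.inl (hyz hy)
      · exact Or.inr ⟨g, hg, hyz hy⟩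
    · obtain ⟨K, hBK, hK⟩ := wbS_exists_wb hbc hw (h𝒢 G hG)
      refine GCov_trans (GCov_forall K
        (fun k y => PatchGen.l {k} ∈ y ∨ ∃ g ∈ G, PatchGen.r g ∈ y) ?_ x fun k hk => ?_) ?_
      · rintro G y z hyz (hy | ⟨g, hg, hy⟩)
        · exact Or.inl (hyz hy)
        · exact Or.inr ⟨g, hg, hyz hy⟩
      · obtain ⟨g, hg, hkg⟩ := hK k hk
        refine lawson_Loc hkg fun y _ hy => ?_
        rcases hy with hy | hy
        · exact GCov.refl (Or.inl hy)
        · exact GCov.refl (Or.inr ⟨g, hg, hy⟩)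
      · rintro y ⟨-, hy⟩
        by_cases hg : ∃ g ∈ G, PatchGen.r g ∈ y
        · exact GCov.refl (Or.inr hg)
        · exact lawson_l_of_singletons hbc K y (fun k hk => (hy k hk).resolve_right hg)
            fun z _ hz => lawson_l_mono hz hBK fun v _ hv => GCov.refl (Or.inl hv)
    · rintro y ⟨-, hy⟩
      by_cases hB : PatchGen.l B ∈ y
      · exact GCov.refl ⟨_, Or.inr rfl, by simpa [patchToLawson] using hB⟩
      · have hy' : ∀ G ∈ 𝒢, ∃ g ∈ G, PatchGen.r g ∈ y :=
          fun G hG => (hy G hG).resolve_left hB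
        refine GCov.refl ⟨_, Or.inl rfl, fun q hq => ?_⟩
        rw [Finset.mem_singleton.1 hq]
        refine ⟨(𝒢.biUnion id).filter fun g => PatchGen.r g ∈ y,
          fun c hc => (Finset.mem_filter.1 hc).2, fun A' hA' U hU => ?_⟩
        rw [Finset.mem_singleton.1 hA'] at hU
        obtain ⟨G, hG, hGU⟩ := Set.mem_iUnion₂.1 (hA𝒢 hU)
        obtain ⟨g, hg, hgy⟩ := hy' G hG
        exact ⟨g, Finset.mem_filter.2 ⟨Finset.mem_biUnion.2 ⟨G, hG, hg⟩, hgy⟩,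
          covS_of_wbS hbc hGU g hg⟩
  | D A =>
    obtain ⟨C, hC, h⟩ := hx (PatchGen.l {A}) (by simp)
    have hA : PatchGen.l A ∈ x := hx (PatchGen.r A) (by simp)
    exact lawson_bot_of_hitting hA hC (h A (by simp))

theorem lawsonToPatch_interp (hbc : IsBasicCover cov) (hw : IsContinuous cov w)
    (A : Finset (PatchGen S)) (𝒞 : Set (Finset (PatchGen S)))
    (hT : LawsonThy cov A 𝒞) (x : Finset (PatchGen (Finset S)))
    (hx : ∀ p ∈ A, lawsonToPatch cov p x) :
    GCov (PatchThy (scottCov cov) supord) x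
      {y | ∃ B ∈ 𝒞, ∀ p ∈ B, lawsonToPatch cov p y} := by
  cases hT with
  | R3 a A h =>
    obtain ⟨b, hba, hb⟩ := hx (PatchGen.r a) (by simp)
    have hbA : wbS cov ↑({b} : Finset S) ↑A := by
      rw [Finset.coe_singleton]
      exact wbS_mono hbc (hbc.covS_of_subset subset_rfl) (wbS_singleton.2 hba)
        (by rintro _ rfl; exact h)
    refine patch_l_split hbc hw hbA hb fun y c _ ⟨u, hu, hcu⟩ hc => ?_
    refine GCov.refl ⟨_, ⟨u, hu, rfl⟩, fun p hp => ?_⟩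
    rw [Finset.mem_singleton.1 hp]
    exact ⟨c, hcu, hc⟩
  | R4 a =>
    obtain ⟨b, hba, hb⟩ := hx (PatchGen.r a) (by simp)
    obtain ⟨K, hbK, hK⟩ := wbS_interpolate hbc hw (wbS_singleton.2 hba)
    rw [← Finset.coe_singleton] at hbK
    refine patch_l_split hbc hw hbK hb fun y c _ ⟨u, hu, hcu⟩ hc => ?_
    obtain ⟨_, rfl, hua⟩ := hK u hu
    refine GCov.refl ⟨_, ⟨u, hua, rfl⟩, fun p hp => ?_⟩
    rw [Finset.mem_singleton.1 hp]
    exact ⟨c, hcu, hc⟩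
  | L1 =>
    exact patch_r_empty hbc fun y _ hy =>
      GCov.refl ⟨_, rfl, by simpa [lawsonToPatch] using hy⟩
  | L2 A B h =>
    exact patch_r_mono hbc (hx (PatchGen.l B) (by simp)) h fun y _ hy =>
      GCov.refl ⟨_, rfl, by simpa [lawsonToPatch] using hy⟩
  | L3 A B =>
    refine patch_R2 (hx (PatchGen.l A) (by simp)) (hx (PatchGen.l B) (by simp))
      fun y C _ hAC hBC hC => ?_
    refine GCov_use (PatchThy.R4 C) (Finset.singleton_subset_iff.2 hC) ?_
    rintro z - ⟨_, ⟨D, hDC, rfl⟩, hD⟩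
    obtain ⟨𝒢, h𝒢, hD𝒢⟩ := scott_wb_exists hbc hw hDC
    refine patch_R3 (Finset.singleton_subset_iff.1 hD) hD𝒢 fun v _ G hG hv => ?_
    have hsub : ∀ E : Finset S, E ⊆ C → wbS cov ↑E ↑G := fun E hE =>
      wbS_mono hbc (hbc.covS_of_subset (Finset.coe_subset.2 hE)) (h𝒢 G hG)
        (hbc.covS_of_subset subset_rfl)
    exact GCov.refl ⟨_, ⟨G, hsub A hAC, hsub B hBC, rfl⟩, by simpa [lawsonToPatch] using hv⟩
  | Loc a b h =>
    have hab : wbS cov ↑({a} : Finset S) {b} := by simpa using wbS_singleton.2 h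
    refine patch_locate hbc hw hab fun y _ hy => ?_
    rcases hy with hy | ⟨c, ⟨_, rfl, hcb⟩, hc⟩
    · exact GCov.refl ⟨_, Or.inl rfl, by simpa [lawsonToPatch] using hy⟩
    · exact GCov.refl ⟨_, Or.inr rfl, by simpa [lawsonToPatch] using ⟨c, hcb, hc⟩⟩
  | D a =>
    obtain ⟨b, hba, hb⟩ := hx (PatchGen.r a) (by simp)
    have ha : PatchGen.r {a} ∈ x := hx (PatchGen.l {a}) (by simp)
    refine patch_r_mono hbc (B := {b}) ha ?_ fun y hxy hy => patch_bot (hxy hb) hy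
    simpa using covS_of_wbS hbc (wbS_singleton.2 hba)

/-- The Lawson topology is the patch of the Scott topology. -/
theorem lawson_iso_patch_scott (hbc : IsBasicCover cov) (hw : IsContinuous cov w) :
    IsIso (lawsonCov cov) (supord : Finset (PatchGen S) → Finset (PatchGen S) → Prop)
      (patchCov (scottCov cov) supord)
      (supord : Finset (PatchGen (Finset S)) → Finset (PatchGen (Finset S)) → Prop) := by
  refine isIso_of_interp patchToLawson_mono lawsonToPatch_mono (patchToLawson_interp hbc hw)
    (lawsonToPatch_interp hbc hw) ?_ ?_ ?_ ?_
  · rintro (a | A) c hc y hy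
    · obtain ⟨b, hba, hb⟩ := hc
      obtain ⟨C, hC, h⟩ := hy _ hb
      refine lawson_Loc hba fun z hyz hz => ?_
      rcases hz with hz | hz
      · exact lawson_bot_of_hitting hz (fun c hc => hyz (hC c hc)) (h {b} (by simp))
      · exact GCov.refl hz
    · exact GCov.refl (hy _ hc)
  · rintro (a | A)
    · refine lawson_R4 (Finset.mem_singleton_self _) fun y b _ hba hy => ?_
      refine GCov.refl ⟨{PatchGen.l {{b}}}, ⟨b, hba, by simp⟩, fun q hq => ?_⟩
      rw [Finset.mem_singleton.1 hq]
      refine ⟨{b}, by simpa using hy, fun A hA U hU => ⟨b, by simp, ?_⟩⟩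
      rw [Finset.mem_singleton.1 hA] at hU
      exact covS_of_wbS hbc hU b (by simp)
    · exact GCov.refl ⟨{PatchGen.r A}, by simp [lawsonToPatch], by simp [patchToLawson]⟩
  · rintro (A | 𝒜) c hc y hy
    · exact GCov.refl (hy _ hc)
    · obtain ⟨C, hC, h⟩ := hc
      have : ∀ c ∈ C, ∃ b, wb cov b c ∧ PatchGen.l {{b}} ∈ y := fun c hc => hy _ (hC c hc)
      choose! f hf hfy using this
      refine patch_l_singletons f y hfy fun z _ hz => ?_
      refine patch_l_mono hz (𝒜 := 𝒜) (fun A hA U hU => ?_) fun v _ hv => GCov.refl hv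
      obtain ⟨c, hc, hcU⟩ := h A hA U hU
      refine Set.mem_iUnion₂.2 ⟨{f c}, Finset.mem_coe.2 (Finset.mem_image_of_mem _ hc), ?_⟩
      have : wbS cov {f c} ↑U := wbS_mono hbc (hbc.covS_of_subset subset_rfl)
        (wbS_singleton.2 (hf c hc)) (by rintro _ rfl; exact hcU)
      simpa [upF] using this
  · rintro (A | 𝒜)
    · exact GCov.refl ⟨{PatchGen.l A}, by simp [patchToLawson], by simp [lawsonToPatch]⟩
    · refine patch_L3 (Finset.mem_singleton_self _) (Finset.mem_singleton_self _)
        fun y 𝒞 _ h𝒞 _ hy => ?_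
      obtain ⟨𝒢, h𝒢, h𝒜⟩ := scott_wbS_exists hbc hw h𝒞
      refine GCov_trans (GCov_forall 𝒢
        (fun G y => ∃ g ∈ G, ∃ b, wb cov b g ∧ PatchGen.l {{b}} ∈ y)
        (fun G y z hyz ⟨g, hg, b, hb, hy⟩ => ⟨g, hg, b, hb, hyz hy⟩) y fun G hG => ?_) ?_
      · obtain ⟨B, hB, hBG⟩ := h𝒢 G hG
        refine patch_l_mono (𝒜 := {B}) hy (fun B' hB' => ?_) fun z _ hz => ?_
        · rw [Finset.mem_singleton.1 (Finset.mem_coe.1 hB')]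
          exact scottCov_isBasicCover.1 _ _ hB
        · exact patch_l_split hbc hw hBG hz fun v b _ ⟨g, hg, hbg⟩ hv =>
            GCov.refl ⟨g, hg, b, hbg, hv⟩
      · rintro z ⟨-, hz⟩
        let C := (𝒢.biUnion id).filter fun g => ∃ b, wb cov b g ∧ PatchGen.l {{b}} ∈ z
        refine GCov.refl ⟨C.image PatchGen.r, ⟨C, fun c hc => Finset.mem_image_of_mem _ hc,
          fun A hA U hU => ?_⟩, fun p hp => ?_⟩
        · obtain ⟨G, hG, hGU⟩ := Set.mem_iUnion₂.1 (h𝒜 A hA hU)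
          obtain ⟨g, hg, hb⟩ := hz G hG
          exact ⟨g, Finset.mem_filter.2 ⟨Finset.mem_biUnion.2 ⟨G, hG, hg⟩, hb⟩,
            covS_of_wbS hbc hGU g hg⟩
        · obtain ⟨c, hc, rfl⟩ := Finset.mem_image.1 hp
          exact (Finset.mem_filter.1 hc).2

end Iso

end FTP

namespace FTP

/-- The Scott topology `Σ(S)` of a continuous basic cover `S` is
the de Groot dual of the lower powerlocale `Lower(S)`; consequently
`L(S) ≅ Patch(Σ(S))`. -/
theorem scott_deGroot_dual_of_lower {S : Type u}
    (cov : S → Set S → Prop) (hbc : IsBasicCover cov)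
    (w : S → Set S) (hw : IsContinuous cov w) :
    IsIso (scottCov cov) (supord : Finset S → Finset S → Prop)
      (DCov (lowerCov cov) supord)
      (supord : Finset (Finset S) → Finset (Finset S) → Prop) ∧
    IsIso (lawsonCov cov) (supord : Finset (PatchGen S) → Finset (PatchGen S) → Prop)
      (patchCov (scottCov cov) supord)
      (supord : Finset (PatchGen (Finset S)) → Finset (PatchGen (Finset S)) → Prop) := by
  exact ⟨scott_iso_dual_lower hbc hw, lawson_iso_patch_scott hbc hw⟩

end FTP
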